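/- arXiv:1409.0103 — 9 statements merged into one kernel-verified Lean document; each statement's English description precedes it below -/
import Mathlib

section
/- Let α > 0. Then: (a) √α ∈ E_α, i.e. there exists x > √α with φ_α(x, √α) ≥ 0 and ψ_α(x, √α) = 0; (b) E_α is a closed subset of ℝ; (c) consequently E_α has a minimum a_c, and 0 < a_c ≤ √α. -/
/-- `φ_α(x, a) = x + a − 2α/√(ax)` -/
noncomputable def phiFun (α x a : ℝ) : ℝ := x + a - 2 * α / Real.sqrt (a * x)

/-- `ψ_α(x, a) = (3/4)(x−a)² + a(x−a) + 2α√a/√x − 2α − 2` -/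
noncomputable def psiFun (α x a : ℝ) : ℝ :=
  (3 / 4) * (x - a) ^ 2 + a * (x - a) + 2 * α * Real.sqrt a / Real.sqrt x - 2 * α - 2

/-- `E_α = {a > 0 : ∃ x > a, φ_α(x,a) ≥ 0 and ψ_α(x,a) = 0}` -/
noncomputable def Eset (α : ℝ) : Set ℝ :=
  {a : ℝ | 0 < a ∧ ∃ x, a < x ∧ 0 ≤ phiFun α x a ∧ psiFun α x a = 0}

theorem phiFun_nonneg_iff {α x a : ℝ} (ha : 0 < a) (hx : 0 < x) :
    0 ≤ phiFun α x a ↔ 2 * α ≤ (x + a) * Real.sqrt (a * x) := by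
  have h : 0 < Real.sqrt (a * x) := Real.sqrt_pos.2 (mul_pos ha hx)
  rw [phiFun, sub_nonneg, div_le_iff₀ h]

theorem psiFun_eq_zero_iff {α x a : ℝ} (hx : 0 < x) :
    psiFun α x a = 0 ↔
      ((3 / 4) * (x - a) ^ 2 + a * (x - a) - 2 * α - 2) * Real.sqrt x
        + 2 * α * Real.sqrt a = 0 := by
  have h : Real.sqrt x ≠ 0 := (Real.sqrt_pos.2 hx).ne'
  have key : psiFun α x a * Real.sqrt x =
      ((3 / 4) * (x - a) ^ 2 + a * (x - a) - 2 * α - 2) * Real.sqrt x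
        + 2 * α * Real.sqrt a := by
    rw [psiFun]
    field_simp
    ring
  rw [← key, mul_eq_zero, or_iff_left h]

theorem psiFun_self {α a : ℝ} (ha : 0 < a) : psiFun α a a = -2 := by
  have h : Real.sqrt a ≠ 0 := (Real.sqrt_pos.2 ha).ne'
  rw [psiFun, mul_div_cancel_right₀ _ h]
  ring

/-- For `x ≥ a + 2α + 3` the quadratic part of `ψ_α(x, a)` already makes it positive. -/
theorem psiFun_pos {α x a : ℝ} (hα : 0 < α) (ha : 0 < a) (hx : a + (2 * α + 3) ≤ x) :
    0 < psiFun α x a := by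
  have h : 0 ≤ 2 * α * Real.sqrt a / Real.sqrt x := by positivity
  have h₁ : 0 ≤ a * (x - a) := mul_nonneg ha.le (by linarith)
  have h₂ : (2 * α + 3) ^ 2 ≤ (x - a) ^ 2 := by
    gcongr
    linarith
  rw [psiFun]
  nlinarith [sq_nonneg α]

theorem sqrt_mem_Eset {α : ℝ} (hα : 0 < α) : Real.sqrt α ∈ Eset α := by
  set a := Real.sqrt α
  have ha : 0 < a := Real.sqrt_pos.2 hα
  have hsq : a ^ 2 = α := Real.sq_sqrt hα.le
  have hcont : ContinuousOn (fun x => psiFun α x a) (Set.Icc a (a + (2 * α + 3))) := by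
    have hne : ∀ x ∈ Set.Icc a (a + (2 * α + 3)), Real.sqrt x ≠ 0 := fun x hx =>
      (Real.sqrt_pos.2 (ha.trans_le hx.1)).ne'
    unfold psiFun
    fun_prop (disch := assumption)
  obtain ⟨x, hx, hx0⟩ := intermediate_value_Ioo (by linarith) hcont
    (show (0 : ℝ) ∈ Set.Ioo _ _ from
      ⟨by simp only [psiFun_self ha]; norm_num, psiFun_pos hα ha le_rfl⟩)
  have hax : a < x := hx.1
  refine ⟨ha, x, hax, (phiFun_nonneg_iff ha (ha.trans hax)).2 ?_, hx0⟩
  have h : a ≤ Real.sqrt (a * x) := Real.le_sqrt_of_sq_le (by nlinarith)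
  nlinarith

/-- `E_α` as the projection, along a compact interval, of a set cut out by continuous
conditions. -/
theorem Eset_eq_image_snd {α : ℝ} (hα : 0 < α) :
    Eset α = Prod.snd '' {p : Set.Icc (0 : ℝ) (2 * α + 3) × ℝ |
      0 ≤ p.2 ∧ 2 * α ≤ (p.2 + p.1 + p.2) * Real.sqrt (p.2 * (p.2 + p.1)) ∧
      ((3 / 4) * (p.1 : ℝ) ^ 2 + p.2 * p.1 - 2 * α - 2) * Real.sqrt (p.2 + p.1)
        + 2 * α * Real.sqrt p.2 = 0} := by
  ext a
  constructor
  · rintro ⟨ha, x, hax, hφ, hψ⟩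
    have hx : 0 < x := ha.trans hax
    have hle : x ≤ a + (2 * α + 3) := by
      by_contra! h
      exact (psiFun_pos hα ha h.le).ne' hψ
    refine ⟨(⟨x - a, by linarith, by linarith⟩, a), ⟨ha.le, ?_, ?_⟩, rfl⟩
    · simpa using (phiFun_nonneg_iff ha hx).1 hφ
    · simpa using (psiFun_eq_zero_iff hx).1 hψ
  · rintro ⟨⟨⟨t, ht⟩, b⟩, ⟨hb, hφ, hψ⟩, rfl⟩
    dsimp only at hb hφ hψ ⊢
    have hb : 0 < b := by
      refine hb.lt_of_ne ?_
      rintro rfl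
      simp at hφ
      linarith
    have hbt : 0 < b + t := add_pos_of_pos_of_nonneg hb ht.1
    have hψ' : psiFun α (b + t) b = 0 :=
      (psiFun_eq_zero_iff hbt).2 (by simpa using hψ)
    refine ⟨hb, b + t, ?_, (phiFun_nonneg_iff hb hbt).2 hφ, hψ'⟩
    have ht0 : t ≠ 0 := by
      rintro rfl
      rw [add_zero, psiFun_self hb] at hψ'
      norm_num at hψ'
    linarith [ht.1.lt_of_ne' ht0]

theorem isClosed_Eset {α : ℝ} (hα : 0 < α) : IsClosed (Eset α) := by
  rw [Eset_eq_image_snd hα]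
  apply isClosedMap_snd_of_compactSpace
  simp only [Set.ofPred_and]
  refine IsClosed.inter (isClosed_le ?_ ?_)
    (IsClosed.inter (isClosed_le ?_ ?_) (isClosed_eq ?_ ?_)) <;> fun_prop

/-- For `α > 0`: (a) `√α ∈ E_α`; (b) `E_α` is closed; (c) `E_α` has a minimum `a_c`
with `0 < a_c ≤ √α`. -/
theorem sqrt_mem_Eset_isClosed_and_min (α : ℝ) (hα : 0 < α) :
    Real.sqrt α ∈ Eset α ∧ IsClosed (Eset α) ∧
      ∃ a_c : ℝ, IsLeast (Eset α) a_c ∧ 0 < a_c ∧ a_c ≤ Real.sqrt α := by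
  have hmem := sqrt_mem_Eset hα
  have hleast := (isClosed_Eset hα).isLeast_csInf ⟨_, hmem⟩ ⟨0, fun _ h => h.1.le⟩
  exact ⟨hmem, isClosed_Eset hα, _, hleast, hleast.1.1, hleast.2 hmem⟩
end

section
/- Let α > 0 and 0 < a₁ < a₂. Suppose x₁ > a₁ satisfies ψ_α(x₁, a₁) = 0 and φ_α(x₁, a₁) ≥ 0, and x₂ > a₂ satisfies ψ_α(x₂, a₂) = 0. Then x₁ ≤ x₂. -/
/-- Decreasing in `a`: where `φ_α(x, a) ≥ 0`, increasing `a` does not increase `ψ_α(x, a)`. -/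
theorem psiFun_le_of_phiFun_nonneg {α x a b : ℝ} (hx : 0 < x) (ha : 0 < a) (hab : a ≤ b)
    (hφ : 0 ≤ phiFun α x a) : psiFun α x b ≤ psiFun α x a := by
  unfold phiFun at hφ
  unfold psiFun
  have hb : 0 < b := ha.trans_le hab
  rw [Real.sqrt_mul ha.le] at hφ
  have hst : √a ≤ √b := Real.sqrt_le_sqrt hab
  have hs : 0 < √a := Real.sqrt_pos.2 ha
  have hu : 0 < √x := Real.sqrt_pos.2 hx
  have hsa := Real.sq_sqrt ha.le
  have htb := Real.sq_sqrt hb.le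
  generalize √a = s at *
  generalize √b = t at *
  generalize √x = u at *
  subst hsa htb
  have hc : 2 * α / u ≤ s * (x + s ^ 2) := by
    have h : 2 * α / (s * u) * s = 2 * α / u := by field_simp
    nlinarith
  have hle : s * (x + s ^ 2) ≤ (t + s) * (2 * x + t ^ 2 + s ^ 2) / 4 := by
    have h : 2 * s * (2 * x + s ^ 2 + s ^ 2) ≤ (t + s) * (2 * x + t ^ 2 + s ^ 2) := by
      have h' : 2 * s ≤ t + s := by linarith
      have h'' : 0 ≤ t + s := by linarith
      gcongr
    linarith
  have key := mul_nonneg (sub_nonneg.2 hst) (sub_nonneg.2 (hc.trans hle))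
  have e₁ : 2 * α * s / u = s * (2 * α / u) := by ring
  have e₂ : 2 * α * t / u = t * (2 * α / u) := by ring
  rw [e₁, e₂]
  linarith

/-- The function `ψ_α(·, a)` lies below its chord over `[a, x]`. -/
theorem psiFun_mul_le_chord {α a y x : ℝ} (hα : 0 < α) (ha : 0 < a) (hay : a < y) (hyx : y < x) :
    (x - a) * psiFun α y a ≤ (x - y) * psiFun α a a + (y - a) * psiFun α x a := by
  unfold psiFun
  have hy : 0 < y := ha.trans hay
  have hx : 0 < x := hy.trans hyx
  have htv : √a < √y := Real.sqrt_lt_sqrt ha.le hay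
  have hvu : √y < √x := Real.sqrt_lt_sqrt hy.le hyx
  have ht : 0 < √a := Real.sqrt_pos.2 ha
  have hta := Real.sq_sqrt ha.le
  have hvy := Real.sq_sqrt hy.le
  have hux := Real.sq_sqrt hx.le
  have hquad : 0 ≤ (x - y) * (y - a) * (x - a) :=
    mul_nonneg (mul_nonneg (by linarith) (by linarith)) (by linarith)
  generalize √a = t at *
  generalize √y = v at *
  generalize √x = u at *
  have hv : 0 < v := ht.trans htv
  have hu : 0 < u := hv.trans hvu
  have hroot : 0 ≤ (x - y) * (2 * α * t / t) + (y - a) * (2 * α * t / u)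
      - (x - a) * (2 * α * t / v) := by
    have h : (x - y) * (2 * α * t / t) + (y - a) * (2 * α * t / u) - (x - a) * (2 * α * t / v)
        = 2 * α * ((u - v) * (v - t) * (u - t) * (u + v + t)) / (u * v) := by
      rw [← hta, ← hvy, ← hux]
      field_simp
      ring
    rw [h]
    have h₁ := sub_pos.2 hvu
    have h₂ := sub_pos.2 htv
    have h₃ := sub_pos.2 (htv.trans hvu)
    positivity
  linarith

/-- Monotonicity: if `0 < a₁ < a₂`, `x₁ > a₁` satisfies `ψ_α(x₁,a₁) = 0` and
`φ_α(x₁,a₁) ≥ 0`, and `x₂ > a₂` satisfies `ψ_α(x₂,a₂) = 0`, then `x₁ ≤ x₂`. -/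
theorem psi_root_mono (α a₁ a₂ x₁ x₂ : ℝ) (hα : 0 < α)
    (ha₁ : 0 < a₁) (ha : a₁ < a₂)
    (hx₁ : a₁ < x₁) (hψ₁ : psiFun α x₁ a₁ = 0) (hφ₁ : 0 ≤ phiFun α x₁ a₁)
    (hx₂ : a₂ < x₂) (hψ₂ : psiFun α x₂ a₂ = 0) :
    x₁ ≤ x₂ := by
  by_contra! h
  have hle := psiFun_le_of_phiFun_nonneg (ha₁.trans hx₁) ha₁ ha.le hφ₁
  have ha₂ : 0 < a₂ := ha₁.trans ha
  have hchord := psiFun_mul_le_chord hα ha₂ hx₂ h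
  have hdiag : psiFun α a₂ a₂ = -2 := by
    have := (Real.sqrt_pos.2 ha₂).ne'
    unfold psiFun
    field_simp
    ring
  rw [hψ₂, hdiag] at hchord
  nlinarith
end

section
/- Let α > 0, let a' ∈ E_α, and let a ≥ a'. If b > a satisfies ψ_α(b, a) = 0, then φ_α(b, a) ≥ 0; in particular a ∈ E_α, so E_α = [min E_α, +∞) ∩ (0, +∞). -/
/-- `ψ_α(at², a)` as a function of `a` and `t`. -/
theorem psiFun_mul_sq (α : ℝ) {a t : ℝ} (ha : 0 < a) (ht : 0 < t) :
    psiFun α (a * t ^ 2) a =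
      a ^ 2 * ((t ^ 2 - 1) * (3 * t ^ 2 + 1)) / 4 + 2 * α / t - 2 * α - 2 := by
  have hs : 0 < Real.sqrt a := Real.sqrt_pos.2 ha
  rw [psiFun, Real.sqrt_mul ha.le, Real.sqrt_sq ht.le]
  field_simp
  ring

/-- `φ_α(at², a)` as a function of `a` and `t`. -/
theorem phiFun_mul_sq (α : ℝ) {a t : ℝ} (ha : 0 < a) (ht : 0 < t) :
    phiFun α (a * t ^ 2) a = a * t ^ 2 + a - 2 * α / (a * t) := by
  rw [phiFun, show a * (a * t ^ 2) = (a * t) ^ 2 by ring, Real.sqrt_sq (by positivity)]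

theorem psiFun_mul_sq_eq_zero_iff (α : ℝ) {a t : ℝ} (ha : 0 < a) (ht : 0 < t) :
    psiFun α (a * t ^ 2) a = 0 ↔
      a ^ 2 * (t * ((t ^ 2 - 1) * (3 * t ^ 2 + 1))) = 8 * t + 8 * α * (t - 1) := by
  have h : a ^ 2 * (t * ((t ^ 2 - 1) * (3 * t ^ 2 + 1))) - (8 * t + 8 * α * (t - 1)) =
      4 * t * psiFun α (a * t ^ 2) a := by
    rw [psiFun_mul_sq α ha ht]
    field_simp
    ring
  rw [← sub_eq_zero (b := 8 * t + 8 * α * (t - 1)), h]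
  simp [ht.ne']

theorem phiFun_mul_sq_nonneg_iff (α : ℝ) {a t : ℝ} (ha : 0 < a) (ht : 1 < t)
    (h : psiFun α (a * t ^ 2) a = 0) :
    0 ≤ phiFun α (a * t ^ 2) a ↔
      α * ((t - 1) ^ 2 * (3 * t ^ 2 + 2 * t + 3)) ≤ 4 * (t * (1 + t ^ 2)) := by
  have ht0 : 0 < t := by linarith
  rw [psiFun_mul_sq_eq_zero_iff α ha ht0] at h
  have hpos : 0 < a * t * ((t ^ 2 - 1) * (3 * t ^ 2 + 1)) := by
    have : 0 < t ^ 2 - 1 := by nlinarith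
    positivity
  have key : a * t * ((t ^ 2 - 1) * (3 * t ^ 2 + 1)) * phiFun α (a * t ^ 2) a =
      2 * (4 * (t * (1 + t ^ 2)) - α * ((t - 1) ^ 2 * (3 * t ^ 2 + 2 * t + 3))) := by
    have hmul : a * t * phiFun α (a * t ^ 2) a = a ^ 2 * t * (1 + t ^ 2) - 2 * α := by
      rw [phiFun_mul_sq α ha ht0]
      field_simp
      ring
    linear_combination ((t ^ 2 - 1) * (3 * t ^ 2 + 1)) * hmul + (1 + t ^ 2) * h
  rw [← mul_nonneg_iff_of_pos_left hpos, key]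
  constructor <;> intro h <;> linarith

/-- The ratio `√(x/a)` at a root of `ψ_α(·, a)` is antitone in `a`. -/
theorem psiFun_root_ratio_antitone {α a a' t t' : ℝ} (ha' : 0 < a') (haa : a' ≤ a)
    (ht' : 1 < t') (h : psiFun α (a * t ^ 2) a = 0)
    (h' : psiFun α (a' * t' ^ 2) a' = 0) : t ≤ t' := by
  by_contra! hlt
  rw [psiFun_mul_sq_eq_zero_iff α (ha'.trans_le haa) (by linarith)] at h
  rw [psiFun_mul_sq_eq_zero_iff α ha' (by linarith)] at h'
  have hy : a' ^ 2 * (t' * (t' + 1) * (3 * t' ^ 2 + 1)) <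
      a ^ 2 * (t * (t + 1) * (3 * t ^ 2 + 1)) := by
    have : t' * (t' + 1) * (3 * t' ^ 2 + 1) < t * (t + 1) * (3 * t ^ 2 + 1) := by gcongr
    have ha : 0 < a := ha'.trans_le haa
    exact mul_lt_mul' (by gcongr) this (by positivity) (by positivity)
  set y := a ^ 2 * (t * (t + 1) * (3 * t ^ 2 + 1)) with hyd
  set y' := a' ^ 2 * (t' * (t' + 1) * (3 * t' ^ 2 + 1)) with hyd'
  have e : (y - 8 * α - 8) * (t - 1) = 8 := by rw [hyd]; linear_combination h
  have e' : (y' - 8 * α - 8) * (t' - 1) = 8 := by rw [hyd']; linear_combination h'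
  have hp : 0 < y' - 8 * α - 8 :=
    pos_of_mul_pos_left (by rw [e']; norm_num) (by linarith : 0 ≤ t' - 1)
  have : (y' - 8 * α - 8) * (t' - 1) < (y - 8 * α - 8) * (t - 1) := by gcongr
  linarith

theorem ratio_bound_of_le {α t t' : ℝ} (hα : 0 ≤ α) (ht : 1 < t) (htt : t ≤ t')
    (h : α * ((t' - 1) ^ 2 * (3 * t' ^ 2 + 2 * t' + 3)) ≤ 4 * (t' * (1 + t' ^ 2))) :
    α * ((t - 1) ^ 2 * (3 * t ^ 2 + 2 * t + 3)) ≤ 4 * (t * (1 + t ^ 2)) := by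
  have ht0 : 0 < t := by linarith
  have ht0' : 0 < t' := by linarith
  have hdiff : 0 ≤ α * ((t' - t) * (t * t' - 1) *
      (3 * (1 + t ^ 2) * (1 + t' ^ 2) + 4 * t * t')) := by
    have h1 : 0 ≤ t' - t := by linarith
    have h2 : 0 ≤ t * t' - 1 := by nlinarith
    positivity
  have hD : 0 < t' * (1 + t' ^ 2) := by positivity
  have hmul := mul_le_mul_of_nonneg_right h (by positivity : 0 ≤ t * (1 + t ^ 2))
  refine le_of_mul_le_mul_right ?_ hD
  linear_combination hmul + hdiff

theorem exists_eq_mul_sq {a x : ℝ} (ha : 0 < a) (hx : a < x) :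
    ∃ t, 1 < t ∧ x = a * t ^ 2 := by
  have h : 1 < x / a := (one_lt_div ha).2 hx
  refine ⟨Real.sqrt (x / a), by simpa using Real.sqrt_lt_sqrt zero_le_one h, ?_⟩
  rw [Real.sq_sqrt (by linarith)]
  field_simp

theorem exists_psiFun_eq_zero {α a : ℝ} (hα : 0 < α) (ha : 0 < a) :
    ∃ x, a < x ∧ psiFun α x a = 0 := by
  have hle : a ≤ a + (2 * α + 2) := by linarith
  have hcont : ContinuousOn (fun x ↦ psiFun α x a) (Set.Icc a (a + (2 * α + 2))) := by
    unfold psiFun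
    have : ∀ x ∈ Set.Icc a (a + (2 * α + 2)), Real.sqrt x ≠ 0 := fun x hx ↦
      (Real.sqrt_pos.2 (ha.trans_le hx.1)).ne'
    fun_prop (disch := assumption)
  have hleft : psiFun α a a = -2 := by
    have : Real.sqrt a ≠ 0 := (Real.sqrt_pos.2 ha).ne'
    unfold psiFun
    field_simp
    ring
  have hright : 0 ≤ psiFun α (a + (2 * α + 2)) a := by
    have h : 0 ≤ 2 * α * Real.sqrt a / Real.sqrt (a + (2 * α + 2)) := by positivity
    unfold psiFun
    nlinarith [mul_pos ha hα]
  obtain ⟨x, hx, hx0⟩ := intermediate_value_Icc hle hcont ⟨by rw [hleft]; norm_num, hright⟩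
  refine ⟨x, lt_of_le_of_ne hx.1 ?_, hx0⟩
  rintro rfl
  have hx0 : psiFun α a a = 0 := hx0
  linarith

theorem phiFun_nonneg_of_mem_Eset {α a' a b : ℝ} (hα : 0 < α) (ha' : a' ∈ Eset α)
    (haa : a' ≤ a) (hab : a < b) (hb : psiFun α b a = 0) : 0 ≤ phiFun α b a := by
  obtain ⟨ha0', x, hx, hphi, hpsi⟩ := ha'
  have ha0 : 0 < a := ha0'.trans_le haa
  obtain ⟨t', ht', rfl⟩ := exists_eq_mul_sq ha0' hx
  obtain ⟨t, ht, rfl⟩ := exists_eq_mul_sq ha0 hab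
  rw [phiFun_mul_sq_nonneg_iff α ha0' ht' hpsi] at hphi
  rw [phiFun_mul_sq_nonneg_iff α ha0 ht hb]
  exact ratio_bound_of_le hα.le ht (psiFun_root_ratio_antitone ha0' haa ht' hb hpsi) hphi

theorem mem_Eset_of_le {α a' a : ℝ} (hα : 0 < α) (ha' : a' ∈ Eset α) (haa : a' ≤ a) :
    a ∈ Eset α := by
  have ha0 : 0 < a := ha'.1.trans_le haa
  obtain ⟨x, hx, hx0⟩ := exists_psiFun_eq_zero hα ha0
  exact ⟨ha0, x, hx, phiFun_nonneg_of_mem_Eset hα ha' haa hx hx0, hx0⟩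

/-- If `a' ∈ E_α` and `a ≥ a'`, then any root `b > a` of `ψ_α(·, a)` satisfies
`φ_α(b, a) ≥ 0`; in particular `a ∈ E_α`, so `E_α = [min E_α, ∞) ∩ (0, ∞)`. -/
theorem Eset_upward_closed (α a' a : ℝ) (hα : 0 < α)
    (ha' : a' ∈ Eset α) (haa : a' ≤ a) :
    (∀ b : ℝ, a < b → psiFun α b a = 0 → 0 ≤ phiFun α b a) ∧
      a ∈ Eset α ∧
      ∀ m : ℝ, IsLeast (Eset α) m → Eset α = Set.Ici m ∩ Set.Ioi 0 := by
  refine ⟨fun b hab hb ↦ phiFun_nonneg_of_mem_Eset hα ha' haa hab hb,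
    mem_Eset_of_le hα ha' haa, fun m hm ↦ ?_⟩
  ext x
  exact ⟨fun hx ↦ ⟨hm.2 hx, hx.1⟩, fun hx ↦ mem_Eset_of_le hα hm.1 hx.1⟩
end

section
/- Let α > 0, let a_c = min E_α, and let b_c be the unique element of (a_c, +∞) with ψ_α(b_c, a_c) = 0. Then φ_α(b_c, a_c) = 0, 0 < a_c < √α < b_c, and b_c = (2/3)·(√(6(α+1) − 2a_c²) − a_c/2). -/
theorem psiFun_add_two {α x a : ℝ} (ha : 0 < a) (hx : 0 < x) :
    psiFun α x a + 2 = (x - a) *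
      ((3 / 4) * (x - a) + a - 2 * α / (Real.sqrt x * (Real.sqrt x + Real.sqrt a))) := by
  have hs := Real.sqrt_pos.2 ha
  have ht := Real.sqrt_pos.2 hx
  have hsa := Real.sq_sqrt ha.le
  have htx := Real.sq_sqrt hx.le
  unfold psiFun
  set s := Real.sqrt a
  set t := Real.sqrt x
  rw [← hsa, ← htx]
  field_simp
  ring

theorem psiFun_lt_psiFun {α a x y : ℝ} (hα : 0 < α) (ha : 0 < a) (hax : a < x) (hxy : x < y)
    (hx : -2 ≤ psiFun α x a) : psiFun α x a < psiFun α y a := by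
  have hx0 := ha.trans hax
  have hy0 := hx0.trans hxy
  have h1 := psiFun_add_two (α := α) ha hx0
  have h2 := psiFun_add_two (α := α) ha hy0
  have hs := Real.sqrt_pos.2 ha
  have ht := Real.sqrt_pos.2 hx0
  have htu := Real.sqrt_le_sqrt hxy.le
  have hq : 2 * α / (√y * (√y + √a)) ≤ 2 * α / (√x * (√x + √a)) := by gcongr
  have hp : 0 ≤ (3 / 4) * (x - a) + a - 2 * α / (√x * (√x + √a)) :=
    nonneg_of_mul_nonneg_right (h1 ▸ by linarith) (sub_pos.2 hax)
  have : (x - a) * ((3 / 4) * (x - a) + a - 2 * α / (√x * (√x + √a))) <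
      (y - a) * ((3 / 4) * (y - a) + a - 2 * α / (√y * (√y + √a))) :=
    mul_lt_mul'' (by linarith) (by linarith) (by linarith) hp
  linarith

theorem psiFun_root_unique {α a x y : ℝ} (hα : 0 < α) (ha : 0 < a) (hx : a < x) (hy : a < y)
    (hψx : psiFun α x a = 0) (hψy : psiFun α y a = 0) : x = y := by
  rcases lt_trichotomy x y with h | h | h
  · linarith [psiFun_lt_psiFun hα ha hx h (by linarith)]
  · exact h
  · linarith [psiFun_lt_psiFun hα ha hy h (by linarith)]

theorem continuousAt_phiFun {α : ℝ} {p : ℝ × ℝ} (hx : 0 < p.1) (ha : 0 < p.2) :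
    ContinuousAt (fun q : ℝ × ℝ => phiFun α q.1 q.2) p := by
  unfold phiFun
  have : √(p.2 * p.1) ≠ 0 := (Real.sqrt_pos.2 (mul_pos ha hx)).ne'
  fun_prop (disch := assumption)

theorem continuousAt_psiFun {α : ℝ} {p : ℝ × ℝ} (hx : 0 < p.1) :
    ContinuousAt (fun q : ℝ × ℝ => psiFun α q.1 q.2) p := by
  unfold psiFun
  have : √p.1 ≠ 0 := (Real.sqrt_pos.2 hx).ne'
  fun_prop (disch := assumption)

open Filter Topology in
/-- `Eset α` contains a left neighbour of every `a` at which the inequality constraint is strict. -/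
theorem exists_lt_mem_Eset {α a b : ℝ} (hα : 0 < α) (ha : 0 < a) (hab : a < b)
    (hφ : 0 < phiFun α b a) (hψ : psiFun α b a = 0) : ∃ a' ∈ Eset α, a' < a := by
  have hb : 0 < b := ha.trans hab
  obtain ⟨U, hU, V, hV, hUV⟩ := mem_nhds_prod_iff.1
    ((continuousAt_phiFun (α := α) (p := (b, a)) hb ha).eventually (lt_mem_nhds hφ))
  obtain ⟨δ, hδ, hball⟩ := Metric.mem_nhds_iff.1 hU
  obtain ⟨ε, hε, hεδ, hεab⟩ : ∃ ε > 0, ε < δ ∧ a < b - ε :=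
    ⟨min δ (b - a) / 2, by have := sub_pos.2 hab; positivity,
      by linarith [min_le_left δ (b - a)], by linarith [min_le_right δ (b - a)]⟩
  have hleft : psiFun α (b - ε) a < 0 := by
    by_contra! h
    linarith [psiFun_lt_psiFun hα ha hεab (by linarith : b - ε < b) (by linarith)]
  have hright : 0 < psiFun α (b + ε) a := by
    linarith [psiFun_lt_psiFun hα ha hab (by linarith : b < b + ε) (by linarith)]
  have hcont (x : ℝ) (hx : 0 < x) : ContinuousAt (fun a' => psiFun α x a') a :=
    (continuousAt_psiFun (α := α) (p := (x, a)) hx).comp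
      (f := fun a' : ℝ => (x, a')) (by fun_prop)
  have hev : ∀ᶠ a' in 𝓝 a, a' ∈ V ∧ 0 < a' ∧ psiFun α (b - ε) a' < 0 ∧
      0 < psiFun α (b + ε) a' := by
    filter_upwards [hV, lt_mem_nhds ha,
      (hcont (b - ε) (by linarith)).eventually (gt_mem_nhds hleft),
      (hcont (b + ε) (by linarith)).eventually (lt_mem_nhds hright)] with a' h1 h2 h3 h4
    exact ⟨h1, h2, h3, h4⟩
  obtain ⟨a', ⟨haV, ha'0, hl, hr⟩, ha'⟩ :=
    ((hev.filter_mono nhdsWithin_le_nhds).and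
      (self_mem_nhdsWithin : Set.Iio a ∈ 𝓝[<] a)).exists
  have hivt : ContinuousOn (fun x => psiFun α x a') (Set.Icc (b - ε) (b + ε)) := fun x hx =>
    ((continuousAt_psiFun (α := α) (p := (x, a')) (by linarith [hx.1] : 0 < x)).comp
      (f := fun y : ℝ => (y, a')) (by fun_prop)).continuousWithinAt
  obtain ⟨x, hx, hx0⟩ := intermediate_value_Icc (by linarith) hivt ⟨hl.le, hr.le⟩
  have ha'a : a' < a := ha'
  refine ⟨a', ⟨ha'0, x, by linarith [hx.1], ?_, hx0⟩, ha'⟩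
  have hxU : x ∈ U := hball (by
    rw [Metric.mem_ball, Real.dist_eq, abs_lt]
    constructor <;> linarith [hx.1, hx.2])
  exact (hUV (Set.mk_mem_prod hxU haV) : 0 < phiFun α x a').le

/-- At `a_c = min E_α` with `b_c` the unique root of `ψ_α(·, a_c)` in `(a_c, ∞)`:
`φ_α(b_c, a_c) = 0`, `0 < a_c < √α < b_c`, and
`b_c = (2/3)(√(6(α+1) − 2 a_c²) − a_c/2)`. -/
theorem critical_endpoint (α a_c b_c : ℝ) (hα : 0 < α)
    (hmin : IsLeast (Eset α) a_c)
    (hb : a_c < b_c) (hψ : psiFun α b_c a_c = 0) :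
    phiFun α b_c a_c = 0 ∧ 0 < a_c ∧ a_c < Real.sqrt α ∧ Real.sqrt α < b_c ∧
      b_c = (2 / 3) * (Real.sqrt (6 * (α + 1) - 2 * a_c ^ 2) - a_c / 2) := by
  obtain ⟨⟨ha, x, hx, hφx, hψx⟩, hlow⟩ := hmin
  obtain rfl := psiFun_root_unique hα ha hx hb hψx hψ
  have hφ : phiFun α x a_c = 0 := by
    refine (hφx.eq_or_lt).elim Eq.symm fun h => ?_
    obtain ⟨a', ha', hlt⟩ := exists_lt_mem_Eset hα ha hb h hψ
    exact absurd (hlow ha') hlt.not_ge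
  have hx0 : 0 < x := ha.trans hx
  have hs := Real.sqrt_pos.2 ha
  have ht := Real.sqrt_pos.2 hx0
  have hst := Real.sqrt_lt_sqrt ha.le hx
  have hsa := Real.sq_sqrt ha.le
  have htx := Real.sq_sqrt hx0.le
  have hαeq : 2 * α = (x + a_c) * (√a_c * √x) := by
    have h := hφ
    rw [phiFun, Real.sqrt_mul ha.le] at h
    field_simp at h
    linarith
  have hmul_gt : a_c < √a_c * √x := by nlinarith
  have hmul_lt : √a_c * √x < x := by nlinarith
  have hquad : 3 * x ^ 2 + 2 * a_c * x + 3 * a_c ^ 2 = 8 * (α + 1) := by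
    have h : 2 * α * √a_c / √x = (x + a_c) * a_c := by
      rw [hαeq]
      field_simp
      rw [hsa]
    have h' := hψ
    rw [psiFun, h] at h'
    linarith
  refine ⟨hφ, ha, Real.lt_sqrt_of_sq_lt (by nlinarith), (Real.sqrt_lt' hx0).2 (by nlinarith), ?_⟩
  have hsqrt : √(6 * (α + 1) - 2 * a_c ^ 2) = (3 * x + a_c) / 2 := by
    rw [show 6 * (α + 1) - 2 * a_c ^ 2 = ((3 * x + a_c) / 2) ^ 2 by linarith]
    exact Real.sqrt_sq (by positivity)
  rw [hsqrt]
  ring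
end

section
/- Let α ≥ 0 and 0 < a < b. Then ∫_a^b (1/(2π))·√((b−x)/(x−a))·(2x + b − a − 2α·√(a/b)·(1/x)) dx = (3/8)(b−a)² + (a/2)(b−a) + α(√(a/b) − 1). -/
/-- `f_{α,a,b}(x) = (1/(2π))·√((b−x)/(x−a))·(2x + b − a − 2α√(a/b)/x)` -/
noncomputable def densF (α a b x : ℝ) : ℝ :=
  (1 / (2 * Real.pi)) * Real.sqrt ((b - x) / (x - a)) *
    (2 * x + b - a - 2 * α * Real.sqrt (a / b) / x)

open Set MeasureTheory in
/-- The fundamental theorem of calculus for a nonnegative, possibly unbounded, derivative: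
integrability is automatic. -/
theorem integrableOn_and_integral_Ioo_of_hasDerivAt_of_nonneg {g g' : ℝ → ℝ} {a b : ℝ}
    (hab : a ≤ b) (hcont : ContinuousOn g (Icc a b))
    (hderiv : ∀ x ∈ Ioo a b, HasDerivAt g (g' x) x) (hpos : ∀ x ∈ Ioo a b, 0 ≤ g' x) :
    IntegrableOn g' (Ioo a b) ∧ ∫ x in Ioo a b, g' x = g b - g a := by
  have hint := intervalIntegral.integrableOn_deriv_of_nonneg hcont hderiv hpos
  refine ⟨hint.mono_set Ioo_subset_Ioc_self, ?_⟩
  rw [← integral_Ioc_eq_integral_Ioo, ← intervalIntegral.integral_of_le hab]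
  exact intervalIntegral.integral_eq_sub_of_hasDerivAt_of_le hab hcont hderiv
    ((intervalIntegrable_iff_integrableOn_Ioc_of_le hab).2 hint)

/-- The derivative of `arcsin ∘ u` from an explicit square root of `1 - u ^ 2`. -/
theorem HasDerivAt.arcsin_of_sq_add_sq {u : ℝ → ℝ} {u' c x : ℝ} (hu : HasDerivAt u u' x)
    (hc : 0 < c) (h : u x ^ 2 + c ^ 2 = 1) :
    HasDerivAt (fun y => Real.arcsin (u y)) (u' / c) x := by
  have h₁ : u x ≠ -1 := fun h' => by rw [h'] at h; nlinarith
  have h₂ : u x ≠ 1 := fun h' => by rw [h'] at h; nlinarith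
  have hsqrt : Real.sqrt (1 - u x ^ 2) = c := by
    rw [← h, add_sub_cancel_left, Real.sqrt_sq hc.le]
  refine ((Real.hasDerivAt_arcsin h₁ h₂).comp x hu).congr_deriv ?_
  rw [hsqrt]
  ring

theorem sqrt_div_eq_div_sqrt_mul {a b x : ℝ} (hx : x ∈ Set.Ioo a b) :
    Real.sqrt ((b - x) / (x - a)) = (b - x) / Real.sqrt ((b - x) * (x - a)) := by
  have h₁ : 0 < b - x := sub_pos.2 hx.2
  have h₂ : 0 < x - a := sub_pos.2 hx.1
  rw [Real.sqrt_div h₁.le, Real.sqrt_mul h₁.le, div_mul_eq_div_div, Real.div_sqrt]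

theorem hasDerivAt_sqrt_mul_sub {a b x : ℝ} (hx : x ∈ Set.Ioo a b) :
    HasDerivAt (fun y => Real.sqrt ((b - y) * (y - a)))
      ((a + b - 2 * x) / (2 * Real.sqrt ((b - x) * (x - a)))) x := by
  have hne : (b - x) * (x - a) ≠ 0 := (mul_pos (sub_pos.2 hx.2) (sub_pos.2 hx.1)).ne'
  refine ((((hasDerivAt_id x).const_sub b).mul
    ((hasDerivAt_id x).sub_const a)).sqrt hne).congr_deriv ?_
  simp only [id, Pi.mul_apply]
  ring

theorem hasDerivAt_arcsin_affine {a b x : ℝ} (hx : x ∈ Set.Ioo a b) :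
    HasDerivAt (fun y => Real.arcsin ((2 * y - a - b) / (b - a)))
      (1 / Real.sqrt ((b - x) * (x - a))) x := by
  have hpos : 0 < (b - x) * (x - a) := mul_pos (sub_pos.2 hx.2) (sub_pos.2 hx.1)
  have hs := Real.sqrt_pos.2 hpos
  have hsq := Real.sq_sqrt hpos.le
  set s := Real.sqrt ((b - x) * (x - a))
  have hL : 0 < b - a := sub_pos.2 (hx.1.trans hx.2)
  have hu : HasDerivAt (fun y => (2 * y - a - b) / (b - a)) (2 / (b - a)) x := by
    simpa using ((((hasDerivAt_id x).const_mul 2).sub_const a).sub_const b).div_const (b - a)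
  convert hu.arcsin_of_sq_add_sq (c := 2 * s / (b - a)) (by positivity) ?_ using 1
  · field_simp
  · field_simp
    linear_combination 4 * hsq

theorem hasDerivAt_arcsin_inv {a b x : ℝ} (ha : 0 < a) (hx : x ∈ Set.Ioo a b) :
    HasDerivAt (fun y => Real.arcsin (((a + b) - 2 * a * b / y) / (b - a)))
      (Real.sqrt (a * b) / (x * Real.sqrt ((b - x) * (x - a)))) x := by
  have hx0 : 0 < x := ha.trans hx.1
  have hab : 0 < a * b := mul_pos ha (hx0.trans hx.2)
  have hpos : 0 < (b - x) * (x - a) := mul_pos (sub_pos.2 hx.2) (sub_pos.2 hx.1)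
  have hs := Real.sqrt_pos.2 hpos
  have hsq := Real.sq_sqrt hpos.le
  have hr := Real.sqrt_pos.2 hab
  have hrq := Real.sq_sqrt hab.le
  set s := Real.sqrt ((b - x) * (x - a))
  set r := Real.sqrt (a * b)
  have hL : 0 < b - a := sub_pos.2 (hx.1.trans hx.2)
  have hu : HasDerivAt (fun y => ((a + b) - 2 * a * b / y) / (b - a))
      (2 * r ^ 2 / (x ^ 2 * (b - a))) x := by
    refine ((((hasDerivAt_inv hx0.ne').const_mul (2 * a * b)).const_sub (a + b)).div_const
      (b - a)).congr_deriv ?_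
    rw [hrq]
    field_simp
  convert hu.arcsin_of_sq_add_sq (c := 2 * r * s / (x * (b - a))) (by positivity) ?_ using 1
  · field_simp
  · field_simp
    linear_combination 4 * r ^ 2 * hsq + 4 * (b - x) * (x - a) * hrq

open Set MeasureTheory in
theorem integral_sqrt_div_mul_affine {a b : ℝ} (ha : 0 < a) (hab : a < b) :
    IntegrableOn (fun x => Real.sqrt ((b - x) / (x - a)) * (2 * x + b - a)) (Ioo a b) ∧
      ∫ x in Ioo a b, Real.sqrt ((b - x) / (x - a)) * (2 * x + b - a) =
        Real.pi * ((3 / 4) * (b - a) ^ 2 + a * (b - a)) := by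
  have hL : b - a ≠ 0 := (sub_pos.2 hab).ne'
  obtain ⟨hint, heq⟩ := integrableOn_and_integral_Ioo_of_hasDerivAt_of_nonneg
    (g := fun x => (x + (a + b) / 2) * Real.sqrt ((b - x) * (x - a)) +
      (b ^ 2 - (a + b) ^ 2 / 4) * Real.arcsin ((2 * x - a - b) / (b - a)))
    (g' := fun x => Real.sqrt ((b - x) / (x - a)) * (2 * x + b - a)) hab.le
    (by
      refine Continuous.continuousOn ?_
      exact (by fun_prop : Continuous fun x : ℝ => _).add
        (continuous_const.mul (Real.continuous_arcsin.comp (by fun_prop))))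
    (fun x hx => by
      have hpos : 0 < (b - x) * (x - a) := mul_pos (sub_pos.2 hx.2) (sub_pos.2 hx.1)
      have hs := Real.sqrt_pos.2 hpos
      have hsq := Real.sq_sqrt hpos.le
      refine ((((hasDerivAt_id x).add_const ((a + b) / 2)).mul (hasDerivAt_sqrt_mul_sub hx)).add
        ((hasDerivAt_arcsin_affine hx).const_mul (b ^ 2 - (a + b) ^ 2 / 4))).congr_deriv ?_
      rw [sqrt_div_eq_div_sqrt_mul hx]
      set s := Real.sqrt ((b - x) * (x - a))
      simp only [id]
      field_simp
      linear_combination 16 * hsq)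
    (fun x hx => mul_nonneg (Real.sqrt_nonneg _) (by linarith [hx.1, hx.2]))
  refine ⟨hint, heq.trans ?_⟩
  have h₁ : (2 * b - a - b) / (b - a) = 1 := by field_simp; ring
  have h₂ : (2 * a - a - b) / (b - a) = -1 := by field_simp; ring
  simp only [h₁, h₂, sub_self, zero_mul, mul_zero, Real.sqrt_zero, Real.arcsin_one,
    Real.arcsin_neg_one]
  ring

open Set MeasureTheory in
theorem integral_sqrt_div_div {a b : ℝ} (ha : 0 < a) (hab : a < b) :
    IntegrableOn (fun x => Real.sqrt ((b - x) / (x - a)) / x) (Ioo a b) ∧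
      ∫ x in Ioo a b, Real.sqrt ((b - x) / (x - a)) / x =
        Real.pi * (b / Real.sqrt (a * b) - 1) := by
  have hL : b - a ≠ 0 := (sub_pos.2 hab).ne'
  have hb : 0 < b := ha.trans hab
  have hr := Real.sqrt_pos.2 (mul_pos ha hb)
  obtain ⟨hint, heq⟩ := integrableOn_and_integral_Ioo_of_hasDerivAt_of_nonneg
    (g := fun x => b / Real.sqrt (a * b) *
        Real.arcsin (((a + b) - 2 * a * b / x) / (b - a)) -
      Real.arcsin ((2 * x - a - b) / (b - a)))
    (g' := fun x => Real.sqrt ((b - x) / (x - a)) / x) hab.le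
    (by
      refine ContinuousOn.sub (continuousOn_const.mul
        (Real.continuous_arcsin.comp_continuousOn ?_))
        (Real.continuous_arcsin.comp (by fun_prop)).continuousOn
      exact (continuousOn_const.sub (continuousOn_const.div continuousOn_id
        fun x hx => (ha.trans_le hx.1).ne')).div_const _)
    (fun x hx => by
      have hx0 : 0 < x := ha.trans hx.1
      have hs := Real.sqrt_pos.2 (mul_pos (sub_pos.2 hx.2) (sub_pos.2 hx.1))
      refine (((hasDerivAt_arcsin_inv ha hx).const_mul (b / Real.sqrt (a * b))).sub
        (hasDerivAt_arcsin_affine hx)).congr_deriv ?_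
      rw [sqrt_div_eq_div_sqrt_mul hx]
      field_simp)
    (fun x hx => div_nonneg (Real.sqrt_nonneg _) (ha.trans hx.1).le)
  refine ⟨hint, heq.trans ?_⟩
  have h₁ : (2 * b - a - b) / (b - a) = 1 := by field_simp; ring
  have h₂ : (2 * a - a - b) / (b - a) = -1 := by field_simp; ring
  have h₃ : ((a + b) - 2 * a * b / b) / (b - a) = 1 := by field_simp; ring
  have h₄ : ((a + b) - 2 * a * b / a) / (b - a) = -1 := by field_simp; ring
  simp only [h₁, h₂, h₃, h₄, Real.arcsin_one, Real.arcsin_neg_one]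
  ring

/-- `∫_a^b f_{α,a,b}(x) dx = (3/8)(b−a)² + (a/2)(b−a) + α(√(a/b) − 1)`. -/
theorem integral_densF (α a b : ℝ) (hα : 0 ≤ α) (ha : 0 < a) (hab : a < b) :
    ∫ x in Set.Ioo a b, densF α a b x =
      (3 / 8) * (b - a) ^ 2 + (a / 2) * (b - a) + α * (Real.sqrt (a / b) - 1) := by
  have hb : 0 < b := ha.trans hab
  obtain ⟨hint₁, heq₁⟩ := integral_sqrt_div_mul_affine ha hab
  obtain ⟨hint₂, heq₂⟩ := integral_sqrt_div_div ha hab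
  have hsplit : ∀ x, densF α a b x =
      1 / (2 * Real.pi) * (Real.sqrt ((b - x) / (x - a)) * (2 * x + b - a)) -
        α * Real.sqrt (a / b) / Real.pi * (Real.sqrt ((b - x) / (x - a)) / x) := fun x => by
    unfold densF
    ring
  simp only [hsplit]
  rw [MeasureTheory.integral_sub (hint₁.const_mul _) (hint₂.const_mul _),
    MeasureTheory.integral_const_mul, MeasureTheory.integral_const_mul, heq₁, heq₂]
  have hprod : Real.sqrt (a / b) * (b / Real.sqrt (a * b)) = 1 := by
    have h₁ := Real.sqrt_pos.2 ha
    have h₂ := Real.sqrt_pos.2 hb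
    rw [Real.sqrt_div ha.le, Real.sqrt_mul ha.le]
    field_simp
    exact (Real.sq_sqrt hb.le).symm
  have hpi := Real.pi_ne_zero
  have hcancel : α * Real.sqrt (a / b) / Real.pi * (Real.pi * (b / Real.sqrt (a * b) - 1)) =
      α * (Real.sqrt (a / b) * (b / Real.sqrt (a * b))) - α * Real.sqrt (a / b) := by
    field_simp
  rw [hcancel, hprod]
  field_simp
  ring
end

section
/- Let 0 < a < b and define U(x) = (1/(2π))·∫_a^b log(1/(x−t))·√((t−a)(b−t))·(1/t) dt. Then for every x ≥ b, U(x) = −(1/2)(x − √(ab)·log x) + C_μ + (1/2)·∫_b^x √((t−a)(t−b))·(1/t) dt, where C_μ = (1/4)(a+b)(1 − log((b−a)/4)) − (√(ab)/2)·log((√b + √a)/(√b − √a)). -/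
open Real MeasureTheory Set Filter Topology

lemma one_add_two_mul_cos_add_sq_pos {q : ℝ} (hq : |q| < 1) (θ : ℝ) :
    0 < 1 + 2 * q * cos θ + q ^ 2 := by
  have h1 : q ^ 2 < 1 := (sq_lt_one_iff_abs_lt_one q).2 hq
  nlinarith [sq_nonneg (q + cos θ), sin_sq_add_cos_sq θ, sq_nonneg (1 + q * cos θ),
    sq_nonneg (sin θ), cos_sq_le_one θ, mul_nonneg (sub_nonneg.2 (cos_sq_le_one θ)) (sub_nonneg.2 h1.le)]

lemma one_add_mul_mem_slitPlane {q : ℝ} (hq : |q| < 1) {z : ℂ} (hz : ‖z‖ ≤ 1) :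
    1 + (q : ℂ) * z ∈ Complex.slitPlane := by
  apply Complex.mem_slitPlane_of_norm_lt_one
  rw [norm_mul, Complex.norm_real, norm_eq_abs]
  nlinarith [abs_nonneg q, norm_nonneg z]

lemma normSq_one_add_mul_circleMap (q θ : ℝ) :
    Complex.normSq (1 + q * circleMap 0 1 θ) = 1 + 2 * q * cos θ + q ^ 2 := by
  simp [circleMap, Complex.normSq_apply, Complex.exp_ofReal_mul_I_re,
    Complex.exp_ofReal_mul_I_im]
  linear_combination q ^ 2 * sin_sq_add_cos_sq θ

lemma re_log_one_add_mul_circleMap (q θ : ℝ) :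
    (Complex.log (1 + q * circleMap 0 1 θ)).re = log (1 + 2 * q * cos θ + q ^ 2) / 2 := by
  rw [Complex.log_re, ← normSq_one_add_mul_circleMap, Complex.normSq_eq_norm_sq, log_pow]
  push_cast
  ring

lemma differentiableOn_log_one_add_mul {q : ℝ} :
    DifferentiableOn ℂ (fun z : ℂ => Complex.log (1 + q * z))
      {z : ℂ | 1 + (q : ℂ) * z ∈ Complex.slitPlane} := by
  intro z hz
  exact ((by fun_prop : DifferentiableAt ℂ (fun z : ℂ => 1 + q * z) z).clog
    hz).differentiableWithinAt

lemma isOpen_one_add_mul_mem_slitPlane (q : ℝ) :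
    IsOpen {z : ℂ | 1 + (q : ℂ) * z ∈ Complex.slitPlane} :=
  Complex.isOpen_slitPlane.preimage (by fun_prop)

lemma closedBall_subset_one_add_mul_mem_slitPlane {q : ℝ} (hq : |q| < 1) :
    Metric.closedBall (0 : ℂ) 1 ⊆ {z : ℂ | 1 + (q : ℂ) * z ∈ Complex.slitPlane} :=
  fun _ hz => one_add_mul_mem_slitPlane hq (by simpa using hz)

lemma continuous_log_one_add_mul_circleMap {q : ℝ} (hq : |q| < 1) :
    Continuous fun θ => Complex.log (1 + q * circleMap 0 1 θ) :=
  Continuous.clog (by fun_prop) fun θ => one_add_mul_mem_slitPlane hq (by simp)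

lemma integral_re_eq_of_circleAverage_eq {F : ℂ → ℂ} {v : ℂ}
    (hF : Continuous fun θ => F (circleMap 0 1 θ)) (h : circleAverage F 0 1 = v) :
    ∫ θ in 0..2 * π, (F (circleMap 0 1 θ)).re = 2 * π * v.re := by
  have h1 := Complex.reCLM.intervalIntegral_comp_comm (hF.intervalIntegrable (μ := volume) 0 (2 * π))
  simp only [Complex.reCLM_apply] at h1
  rw [h1, ← h, circleAverage_def, Complex.smul_re]
  simp only [smul_eq_mul]
  field_simp

lemma poissonKernel_circleMap (p θ : ℝ) : poissonKernel 0 p (circleMap 0 1 θ) =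
    (1 - p ^ 2) / (1 + 2 * (-p) * cos θ + p ^ 2) := by
  have h : ‖circleMap 0 1 θ - p‖ ^ 2 = 1 + 2 * (-p) * cos θ + p ^ 2 := by
    rw [← Complex.normSq_eq_norm_sq]
    simp [circleMap, Complex.normSq_apply, Complex.exp_ofReal_mul_I_re,
      Complex.exp_ofReal_mul_I_im]
    linear_combination sin_sq_add_cos_sq θ
  simp [poissonKernel_def, h]

lemma continuous_poissonKernel_circleMap {p : ℝ} (hp : |p| < 1) :
    Continuous fun θ => (1 - p ^ 2) / (1 + 2 * (-p) * cos θ + p ^ 2) :=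
  Continuous.div (by fun_prop) (by fun_prop) fun θ => by
    simpa using (one_add_two_mul_cos_add_sq_pos (q := -p) (by simpa using hp) θ).ne'

lemma integral_poissonKernel_circleMap {p : ℝ} (hp : |p| < 1) :
    ∫ θ in 0..2 * π, (1 - p ^ 2) / (1 + 2 * (-p) * cos θ + p ^ 2) = 2 * π := by
  have hw : (p : ℂ) ∈ Metric.ball (0 : ℂ) 1 := by simpa using hp
  have h := (diffContOnCl_const (c := (1 : ℂ))).circleAverage_poissonKernel_smul hw
  have hc : Continuous fun θ => (poissonKernel 0 p • fun _ : ℂ => (1 : ℂ)) (circleMap 0 1 θ) := by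
    simp only [Pi.smul_apply', poissonKernel_circleMap]
    exact (continuous_poissonKernel_circleMap hp).smul continuous_const
  have h3 := integral_re_eq_of_circleAverage_eq hc h
  simpa only [Pi.smul_apply', poissonKernel_circleMap, Complex.smul_re, Complex.one_re, smul_eq_mul,
    mul_one] using h3

/-- Poisson's formula for the harmonic function `log |1 + q z|`, evaluated at the point `p`. -/
lemma integral_log_mul_poisson {p q : ℝ} (hp : |p| < 1) (hq : |q| < 1) :
    ∫ θ in 0..2 * π, log (1 + 2 * q * cos θ + q ^ 2) *
      ((1 - p ^ 2) / (1 + 2 * (-p) * cos θ + p ^ 2)) = 4 * π * log (1 + p * q) := by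
  have hd : DiffContOnCl ℂ (fun z : ℂ => Complex.log (1 + q * z)) (Metric.ball 0 1) :=
    (differentiableOn_log_one_add_mul.mono
      (closedBall_subset_one_add_mul_mem_slitPlane hq)).diffContOnCl_ball subset_rfl
  have hw : (p : ℂ) ∈ Metric.ball (0 : ℂ) 1 := by simpa using hp
  have hk := poissonKernel_circleMap p
  have h := hd.circleAverage_poissonKernel_smul hw
  have hc : Continuous fun θ =>
      (poissonKernel 0 p • fun z : ℂ => Complex.log (1 + q * z)) (circleMap 0 1 θ) := by
    simp only [Pi.smul_apply', hk]
    exact (continuous_poissonKernel_circleMap hp).smul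
      (continuous_log_one_add_mul_circleMap hq)
  have h3 := integral_re_eq_of_circleAverage_eq hc h
  simp only [Pi.smul_apply', hk, Complex.smul_re, re_log_one_add_mul_circleMap, smul_eq_mul] at h3
  have h4 : (Complex.log (1 + q * (p : ℂ))).re = log (1 + p * q) := by
    rw [← log_abs, Complex.log_re]
    norm_cast
    rw [mul_comm q p, norm_eq_abs]
  rw [h4] at h3
  rw [show 4 * π * log (1 + p * q) = 2 * (2 * π * log (1 + p * q)) by ring, ← h3,
    ← intervalIntegral.integral_const_mul]
  congr 1 with θ
  ring

lemma integral_log_one_add_two_mul_cos {q : ℝ} (hq : |q| < 1) :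
    ∫ θ in 0..2 * π, log (1 + 2 * q * cos θ + q ^ 2) = 0 := by
  simpa using integral_log_mul_poisson (p := 0) (by simp) hq

lemma integral_log_mul_cos {q : ℝ} (hq : |q| < 1) :
    ∫ θ in 0..2 * π, log (1 + 2 * q * cos θ + q ^ 2) * cos θ = 2 * π * q := by
  have hd : DifferentiableOn ℂ (fun z : ℂ => Complex.log (1 + q * z) * ((z ^ 2 + 1) / 2))
      {z : ℂ | 1 + (q : ℂ) * z ∈ Complex.slitPlane} :=
    differentiableOn_log_one_add_mul.mul (by fun_prop)
  have h := Complex.two_pi_I_inv_smul_circleIntegral_sub_sq_inv_smul_of_differentiable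
    (isOpen_one_add_mul_mem_slitPlane q) (closedBall_subset_one_add_mul_mem_slitPlane hq) hd
    (Metric.mem_ball_self one_pos)
  have hderiv : deriv (fun z : ℂ => Complex.log (1 + q * z) * ((z ^ 2 + 1) / 2)) 0 = (q : ℂ) / 2 := by
    have h1 : HasDerivAt (fun z : ℂ => 1 + q * z) (q : ℂ) 0 := by
      simpa using ((hasDerivAt_id (0 : ℂ)).const_mul (q : ℂ)).const_add 1
    have h2 : HasDerivAt (fun z : ℂ => (z ^ 2 + 1) / 2) 0 0 := by
      simpa using (((hasDerivAt_id (0 : ℂ)).pow 2).add_const 1).div_const 2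
    have := ((h1.clog (by simp)).mul h2).deriv
    rw [Pi.mul_def] at this
    simpa [div_eq_mul_inv] using this
  rw [hderiv] at h
  have havg : circleAverage
      (fun z : ℂ => z⁻¹ * (Complex.log (1 + q * z) * ((z ^ 2 + 1) / 2))) 0 1 = (q : ℂ) / 2 := by
    rw [circleAverage_eq_circleIntegral one_ne_zero, ← h]
    congr 2
    ext z
    simp only [sub_zero, smul_eq_mul]
    ring
  have hF : ∀ θ : ℝ, (circleMap 0 1 θ)⁻¹ *
      (Complex.log (1 + q * circleMap 0 1 θ) * (((circleMap 0 1 θ) ^ 2 + 1) / 2)) =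
      (cos θ : ℝ) • Complex.log (1 + q * circleMap 0 1 θ) := by
    intro θ
    have hcos : (cos θ : ℂ) = (circleMap 0 1 θ + (circleMap 0 1 θ)⁻¹) / 2 := by
      rw [Complex.ofReal_cos, Complex.cos, circleMap_zero_inv]
      simp [circleMap]
    have h0 : circleMap 0 1 θ ≠ 0 := circleMap_ne_center one_ne_zero
    rw [Complex.real_smul, hcos]
    field_simp
  have h3 := integral_re_eq_of_circleAverage_eq (v := q / 2) (by
    simp only [hF]
    exact continuous_cos.smul (continuous_log_one_add_mul_circleMap hq)) havg
  simp only [hF, Complex.smul_re, re_log_one_add_mul_circleMap, smul_eq_mul] at h3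
  have h4 : ((q : ℂ) / 2).re = q / 2 := by norm_cast
  rw [h4] at h3
  rw [show 2 * π * q = 2 * (2 * π * (q / 2)) by ring, ← h3, ← intervalIntegral.integral_const_mul]
  congr 1 with θ
  ring

lemma integral_zero_two_pi_comp_cos {g : ℝ → ℝ} (hg : Continuous fun θ => g (cos θ)) :
    ∫ θ in 0..2 * π, g (cos θ) = 2 * ∫ θ in 0..π, g (cos θ) := by
  have h := intervalIntegral.integral_comp_sub_left (a := 0) (b := π) (fun θ => g (cos θ)) (2 * π)
  simp only [cos_two_pi_sub, sub_zero, show 2 * π - π = π by ring] at h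
  rw [← intervalIntegral.integral_add_adjacent_intervals (b := π)
    (hg.intervalIntegrable _ _) (hg.intervalIntegrable _ _), ← h]
  ring

lemma continuous_log_one_add_two_mul_cos {q : ℝ} (hq : |q| < 1) :
    Continuous fun θ => log (1 + 2 * q * cos θ + q ^ 2) :=
  Continuous.log (by fun_prop) fun θ => (one_add_two_mul_cos_add_sq_pos hq θ).ne'

lemma four_mul_sq_mul_sin_sq_div {p : ℝ} (hp : |p| < 1) (θ : ℝ) :
    4 * p ^ 2 * (1 - cos θ ^ 2) / (1 + 2 * (-p) * cos θ + p ^ 2) =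
      1 + p ^ 2 + 2 * p * cos θ
        - (1 - p ^ 2) * ((1 - p ^ 2) / (1 + 2 * (-p) * cos θ + p ^ 2)) := by
  have h := (one_add_two_mul_cos_add_sq_pos (q := -p) (by simpa using hp) θ).ne'
  rw [neg_sq] at h
  rw [eq_sub_iff_add_eq, ← mul_div_assoc, ← add_div, div_eq_iff h]
  ring

lemma integral_marchenkoPastur_weight {p : ℝ} (hp : |p| < 1) :
    ∫ θ in 0..π, 4 * p ^ 2 * (1 - cos θ ^ 2) / (1 + 2 * (-p) * cos θ + p ^ 2) =
      2 * π * p ^ 2 := by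
  have hP := continuous_poissonKernel_circleMap hp
  have h := integral_zero_two_pi_comp_cos
    (g := fun c => 4 * p ^ 2 * (1 - c ^ 2) / (1 + 2 * (-p) * c + p ^ 2)) (by
      simp only [four_mul_sq_mul_sin_sq_div hp]
      fun_prop)
  have h2 : ∫ θ in 0..2 * π, 4 * p ^ 2 * (1 - cos θ ^ 2) / (1 + 2 * (-p) * cos θ + p ^ 2) =
      4 * π * p ^ 2 := by
    simp only [four_mul_sq_mul_sin_sq_div hp]
    rw [intervalIntegral.integral_sub
      (Continuous.intervalIntegrable (by fun_prop) _ _)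
      (Continuous.intervalIntegrable (by fun_prop) _ _),
      intervalIntegral.integral_add
      (Continuous.intervalIntegrable (by fun_prop) _ _)
      (Continuous.intervalIntegrable (by fun_prop) _ _),
      intervalIntegral.integral_const_mul, intervalIntegral.integral_const_mul,
      integral_poissonKernel_circleMap hp]
    simp
    ring
  linarith

lemma integral_log_mul_marchenkoPastur_weight {p q : ℝ} (hp : |p| < 1) (hq : |q| < 1) :
    ∫ θ in 0..π, log (1 + 2 * q * cos θ + q ^ 2) *
        (4 * p ^ 2 * (1 - cos θ ^ 2) / (1 + 2 * (-p) * cos θ + p ^ 2)) =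
      2 * π * (p * q - (1 - p ^ 2) * log (1 + p * q)) := by
  have hP := continuous_poissonKernel_circleMap hp
  have hL := continuous_log_one_add_two_mul_cos hq
  have h := integral_zero_two_pi_comp_cos
    (g := fun c => log (1 + 2 * q * c + q ^ 2) *
      (4 * p ^ 2 * (1 - c ^ 2) / (1 + 2 * (-p) * c + p ^ 2))) (by
      simp only [four_mul_sq_mul_sin_sq_div hp]
      fun_prop)
  have h2 : ∫ θ in 0..2 * π, log (1 + 2 * q * cos θ + q ^ 2) *
        (4 * p ^ 2 * (1 - cos θ ^ 2) / (1 + 2 * (-p) * cos θ + p ^ 2)) =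
      4 * π * (p * q - (1 - p ^ 2) * log (1 + p * q)) := by
    have he : ∀ θ, log (1 + 2 * q * cos θ + q ^ 2) *
        (4 * p ^ 2 * (1 - cos θ ^ 2) / (1 + 2 * (-p) * cos θ + p ^ 2)) =
        (1 + p ^ 2) * log (1 + 2 * q * cos θ + q ^ 2)
        + 2 * p * (log (1 + 2 * q * cos θ + q ^ 2) * cos θ)
        - (1 - p ^ 2) * (log (1 + 2 * q * cos θ + q ^ 2) *
          ((1 - p ^ 2) / (1 + 2 * (-p) * cos θ + p ^ 2))) := fun θ => by
      rw [four_mul_sq_mul_sin_sq_div hp]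
      ring
    simp only [he]
    rw [intervalIntegral.integral_sub
      (Continuous.intervalIntegrable (by fun_prop) _ _)
      (Continuous.intervalIntegrable (by fun_prop) _ _),
      intervalIntegral.integral_add
      (Continuous.intervalIntegrable (by fun_prop) _ _)
      (Continuous.intervalIntegrable (by fun_prop) _ _),
      intervalIntegral.integral_const_mul, intervalIntegral.integral_const_mul,
      intervalIntegral.integral_const_mul, integral_log_one_add_two_mul_cos hq,
      integral_log_mul_cos hq, integral_log_mul_poisson hp hq]
    ring
  linarith

lemma integral_comp_sub_mul_cos {c r : ℝ} (hr : 0 ≤ r) {g : ℝ → ℝ}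
    (hg : ContinuousOn g (Icc (c - r) (c + r))) :
    ∫ t in (c - r)..(c + r), g t = ∫ θ in 0..π, g (c - r * cos θ) * (r * sin θ) := by
  have h := intervalIntegral.integral_comp_mul_deriv' (a := 0) (b := π)
    (f := fun θ => c - r * cos θ) (f' := fun θ => r * sin θ) (g := g)
    (fun θ _ => by simpa using ((hasDerivAt_cos θ).const_mul r).const_sub c)
    (by fun_prop) (hg.mono (by
      rintro _ ⟨θ, _, rfl⟩
      constructor <;> nlinarith [cos_le_one θ, neg_one_le_cos θ]))
  simpa using h.symm

/-- The logarithmic potential outside the support, at the point `x = ρ (1 + p q) (1 + p / q)`. -/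
lemma integral_log_mul_density {ρ p q : ℝ} (hρ : 0 < ρ) (hp : 0 < p) (hp1 : p < 1)
    (hq : 0 < q) (hq1 : q < 1) :
    ∫ t in Ioo (ρ * (1 - p) ^ 2) (ρ * (1 + p) ^ 2),
      log (1 / (ρ * (1 + p * q) * (1 + p / q) - t)) *
        (√((t - ρ * (1 - p) ^ 2) * (ρ * (1 + p) ^ 2 - t)) / t) =
      -(2 * π * ρ * (p ^ 2 * log (ρ * p / q) + p * q - (1 - p ^ 2) * log (1 + p * q))) := by
  have hpa : |p| < 1 := abs_lt.2 ⟨by linarith, hp1⟩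
  have hqa : |q| < 1 := abs_lt.2 ⟨by linarith, hq1⟩
  have ha : 0 < ρ * (1 - p) ^ 2 := mul_pos hρ (pow_pos (by linarith) 2)
  have hab : ρ * (1 - p) ^ 2 ≤ ρ * (1 + p) ^ 2 := by nlinarith [mul_pos hρ hp]
  have hbx : ρ * (1 + p) ^ 2 < ρ * (1 + p * q) * (1 + p / q) := by
    have : ρ * (1 + p * q) * (1 + p / q) - ρ * (1 + p) ^ 2 = ρ * p * (1 - q) ^ 2 / q := by
      field_simp
      ring
    have : 0 < ρ * p * (1 - q) ^ 2 / q := by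
      have : 0 < 1 - q := by linarith
      positivity
    linarith
  rw [← integral_Ioc_eq_integral_Ioo, ← intervalIntegral.integral_of_le hab]
  have hc := integral_comp_sub_mul_cos (c := ρ * (1 + p ^ 2)) (r := 2 * ρ * p) (by positivity)
    (g := fun t => log (1 / (ρ * (1 + p * q) * (1 + p / q) - t)) *
        (√((t - ρ * (1 - p) ^ 2) * (ρ * (1 + p) ^ 2 - t)) / t)) (by
      have h1 : ∀ t ∈ Icc (ρ * (1 + p ^ 2) - 2 * ρ * p) (ρ * (1 + p ^ 2) + 2 * ρ * p),
          ρ * (1 + p * q) * (1 + p / q) - t ≠ 0 := fun t ht => by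
        nlinarith [ht.2]
      refine ContinuousOn.mul (ContinuousOn.log (ContinuousOn.div (by fun_prop) (by fun_prop) h1)
        fun t ht => one_div_ne_zero (h1 t ht)) (ContinuousOn.div (by fun_prop) (by fun_prop) ?_)
      intro t ht
      nlinarith [ht.1])
  rw [show ρ * (1 + p ^ 2) - 2 * ρ * p = ρ * (1 - p) ^ 2 by ring,
    show ρ * (1 + p ^ 2) + 2 * ρ * p = ρ * (1 + p) ^ 2 by ring] at hc
  rw [hc]
  have hL := continuous_log_one_add_two_mul_cos hqa
  have hW : Continuous fun θ =>
      4 * p ^ 2 * (1 - cos θ ^ 2) / (1 + 2 * (-p) * cos θ + p ^ 2) := by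
    have hP := continuous_poissonKernel_circleMap hpa
    simp only [four_mul_sq_mul_sin_sq_div hpa]
    fun_prop
  have he : ∫ θ in 0..π, -ρ * (log (ρ * p / q) *
        (4 * p ^ 2 * (1 - cos θ ^ 2) / (1 + 2 * (-p) * cos θ + p ^ 2)) +
      log (1 + 2 * q * cos θ + q ^ 2) *
        (4 * p ^ 2 * (1 - cos θ ^ 2) / (1 + 2 * (-p) * cos θ + p ^ 2))) =
      -(2 * π * ρ * (p ^ 2 * log (ρ * p / q) + p * q - (1 - p ^ 2) * log (1 + p * q))) := by
    rw [intervalIntegral.integral_const_mul, intervalIntegral.integral_add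
      (Continuous.intervalIntegrable (by fun_prop) _ _)
      (Continuous.intervalIntegrable (by fun_prop) _ _), intervalIntegral.integral_const_mul,
      integral_marchenkoPastur_weight hpa, integral_log_mul_marchenkoPastur_weight hpa hqa]
    ring
  rw [← he]
  refine intervalIntegral.integral_congr fun θ hθ => ?_
  rw [uIcc_of_le pi_pos.le] at hθ
  have hs : 0 ≤ sin θ := sin_nonneg_of_mem_Icc hθ
  have hx : ρ * (1 + p * q) * (1 + p / q) - (ρ * (1 + p ^ 2) - 2 * ρ * p * cos θ) =
      ρ * p / q * (1 + 2 * q * cos θ + q ^ 2) := by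
    field_simp
    ring
  have hsq : √((ρ * (1 + p ^ 2) - 2 * ρ * p * cos θ - ρ * (1 - p) ^ 2) *
      (ρ * (1 + p) ^ 2 - (ρ * (1 + p ^ 2) - 2 * ρ * p * cos θ))) = 2 * ρ * p * sin θ := by
    rw [← sqrt_sq (show 0 ≤ 2 * ρ * p * sin θ by positivity)]
    congr 1
    linear_combination (-4) * ρ ^ 2 * p ^ 2 * sin_sq_add_cos_sq θ
  have hD := (one_add_two_mul_cos_add_sq_pos (q := -p) (by simpa using hpa) θ).ne'
  rw [neg_sq] at hD
  have ht : ρ * (1 + p ^ 2) - 2 * ρ * p * cos θ = ρ * (1 + 2 * (-p) * cos θ + p ^ 2) := by ring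
  simp only [one_div, log_inv]
  rw [hx, hsq, ht, log_mul (by positivity) (one_add_two_mul_cos_add_sq_pos hqa θ).ne',
    ← sin_sq]
  field_simp
  ring

lemma abs_log_le_of_mem_Icc {u v w : ℝ} (hu : 0 < u) (huv : u ≤ v) (hvw : v ≤ w) :
    |log v| ≤ |log u| + |log w| := by
  have h1 := log_le_log hu huv
  have h2 := log_le_log (hu.trans_le huv) hvw
  rw [abs_le]
  constructor
  · linarith [neg_abs_le (log u), abs_nonneg (log w)]
  · linarith [le_abs_self (log w), abs_nonneg (log u)]

lemma continuousWithinAt_integral_log_mul_density {a b : ℝ} (ha : 0 < a) (hab : a < b) :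
    ContinuousWithinAt (fun x => ∫ t in Ioo a b, log (1 / (x - t)) * (√((t - a) * (b - t)) / t))
      (Ioi b) b := by
  refine continuousWithinAt_of_dominated
    (bound := fun t => (|log (b - t)| + |log (b + 1 - t)|) * ((b - a) / a)) ?_ ?_ ?_ ?_
  · exact Eventually.of_forall fun x => Measurable.aestronglyMeasurable (by fun_prop)
  · filter_upwards [Ioo_mem_nhdsGT (lt_add_one b)] with x hx
    refine (ae_restrict_iff' measurableSet_Ioo).2 (Eventually.of_forall fun t ht => ?_)
    have ht0 : 0 < t := ha.trans ht.1
    rw [norm_mul, one_div, log_inv, norm_neg, norm_eq_abs, norm_eq_abs, abs_of_nonneg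
      (div_nonneg (sqrt_nonneg _) ht0.le)]
    have hs : √((t - a) * (b - t)) ≤ b - a := by
      rw [sqrt_le_left (by linarith)]
      nlinarith [ht.1, ht.2]
    have hab' : 0 ≤ b - a := by linarith
    gcongr
    · exact abs_log_le_of_mem_Icc (by linarith [ht.2]) (by linarith [hx.1]) (by linarith [hx.2])
    · exact ht.1.le
  · have h : ∀ c : ℝ, IntegrableOn (fun t => |log (c - t)|) (Ioo a b) := fun c => by
      have h := (intervalIntegral.intervalIntegrable_log' (a := c - a) (b := c - b)).comp_sub_left c
      simp only [sub_sub_cancel] at h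
      exact (((intervalIntegrable_iff_integrableOn_Ioc_of_le hab.le).1 h).mono_set
        Ioo_subset_Ioc_self).abs
    exact ((h b).add (h (b + 1))).mul_const _
  · refine (ae_restrict_iff' measurableSet_Ioo).2 (Eventually.of_forall fun t ht => ?_)
    have h : b - t ≠ 0 := by linarith [ht.2]
    refine ContinuousAt.continuousWithinAt ?_
    refine (ContinuousAt.log (continuousAt_const.div (continuousAt_id.sub continuousAt_const) h)
      (one_div_ne_zero h)).mul continuousAt_const

/-- The inverse on `[b, ∞)` of `q ↦ ρ (1 + p q) (1 + p / q)`, `0 < q ≤ 1`, where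
`a = ρ (1 - p) ^ 2` and `b = ρ (1 + p) ^ 2`. -/
noncomputable def exteriorParam (ρ p x : ℝ) : ℝ :=
  (x - ρ * (1 + p ^ 2) - √((x - ρ * (1 - p) ^ 2) * (x - ρ * (1 + p) ^ 2))) / (2 * ρ * p)

/-- The negative of the logarithmic potential, divided by `ρ`, at the point
`ρ (1 + p q) (1 + p / q)`. -/
noncomputable def exteriorPotential (ρ p q : ℝ) : ℝ :=
  p ^ 2 * log (ρ * p / q) + p * q - (1 - p ^ 2) * log (1 + p * q)

section

variable {ρ p x : ℝ}

lemma exteriorParam_pos (hρ : 0 < ρ) (hp : 0 < p) (hx : ρ * (1 + p) ^ 2 ≤ x) :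
    0 < exteriorParam ρ p x := by
  have hρp := mul_pos hρ hp
  refine div_pos (sub_pos.2 ((sqrt_lt' (by nlinarith)).2 ?_)) (by positivity)
  nlinarith [mul_pos hρp hρp]

lemma sqrt_eq_exteriorParam (hρ : 0 < ρ) (hp : 0 < p) (hx : ρ * (1 + p) ^ 2 ≤ x) :
    √((x - ρ * (1 - p) ^ 2) * (x - ρ * (1 + p) ^ 2)) =
      ρ * p * (1 / exteriorParam ρ p x - exteriorParam ρ p x) := by
  have hQ := exteriorParam_pos hρ hp hx
  have hS := sq_sqrt (show 0 ≤ (x - ρ * (1 - p) ^ 2) * (x - ρ * (1 + p) ^ 2) from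
    mul_nonneg (by nlinarith [mul_pos hρ hp]) (by linarith))
  have hdef : exteriorParam ρ p x * (2 * ρ * p) = x - ρ * (1 + p ^ 2) -
      √((x - ρ * (1 - p) ^ 2) * (x - ρ * (1 + p) ^ 2)) := div_mul_cancel₀ _ (by positivity)
  set S := √((x - ρ * (1 - p) ^ 2) * (x - ρ * (1 + p) ^ 2))
  set Q := exteriorParam ρ p x
  have h : 4 * ρ * p * (S * Q - ρ * p * (1 - Q * Q)) = 0 := by
    linear_combination (2 * S + 2 * ρ * p * Q + x - ρ * (1 + p ^ 2) - S) * hdef - hS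
  have h2 : S * Q = ρ * p * (1 - Q * Q) := by
    have := (mul_eq_zero.1 h).resolve_left (by positivity)
    linarith
  field_simp
  linear_combination h2

lemma eq_exteriorParam (hρ : 0 < ρ) (hp : 0 < p) (hx : ρ * (1 + p) ^ 2 ≤ x) :
    ρ * (1 + p * exteriorParam ρ p x) * (1 + p / exteriorParam ρ p x) = x := by
  have hQ := exteriorParam_pos hρ hp hx
  have hS := sqrt_eq_exteriorParam hρ hp hx
  have hdef : exteriorParam ρ p x * (2 * ρ * p) = x - ρ * (1 + p ^ 2) -
      √((x - ρ * (1 - p) ^ 2) * (x - ρ * (1 + p) ^ 2)) := div_mul_cancel₀ _ (by positivity)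
  rw [hS] at hdef
  set Q := exteriorParam ρ p x
  have h : x = ρ * (1 + p ^ 2) + ρ * p * (1 / Q - Q) + Q * (2 * ρ * p) := by linarith
  rw [h]
  field_simp
  ring

lemma exteriorParam_lt_one (hρ : 0 < ρ) (hp : 0 < p) (hx : ρ * (1 + p) ^ 2 < x) :
    exteriorParam ρ p x < 1 := by
  have hQ := exteriorParam_pos hρ hp hx.le
  have hS := sqrt_eq_exteriorParam hρ hp hx.le
  have hS0 : 0 < √((x - ρ * (1 - p) ^ 2) * (x - ρ * (1 + p) ^ 2)) :=
    sqrt_pos.2 (mul_pos (by nlinarith [mul_pos hρ hp]) (by linarith))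
  rw [hS] at hS0
  by_contra! h
  have h1 : 1 / exteriorParam ρ p x ≤ 1 := (div_le_one hQ).2 h
  nlinarith [mul_pos hρ hp]

lemma exteriorParam_right (hρ : 0 < ρ) (hp : 0 < p) :
    exteriorParam ρ p (ρ * (1 + p) ^ 2) = 1 := by
  simp only [exteriorParam, sub_self, mul_zero, sqrt_zero, sub_zero]
  field_simp
  ring

lemma continuousOn_exteriorPotential (hρ : 0 < ρ) (hp : 0 < p) :
    ContinuousOn (fun x => exteriorPotential ρ p (exteriorParam ρ p x))
      (Ici (ρ * (1 + p) ^ 2)) := by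
  have hQ : ∀ x ∈ Ici (ρ * (1 + p) ^ 2), 0 < exteriorParam ρ p x :=
    fun x hx => exteriorParam_pos hρ hp hx
  have hc : Continuous (exteriorParam ρ p) := by
    unfold exteriorParam
    fun_prop
  unfold exteriorPotential
  refine ((ContinuousOn.log (continuousOn_const.div hc.continuousOn fun x hx => (hQ x hx).ne')
    fun x hx => ?_).const_smul (p ^ 2) |>.add (by fun_prop)).sub
      ((ContinuousOn.log (by fun_prop) fun x hx => ?_).const_smul (1 - p ^ 2))
  · exact (div_pos (mul_pos hρ hp) (hQ x hx)).ne'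
  · exact (add_pos one_pos (mul_pos hp (hQ x hx))).ne'

lemma hasDerivAt_exteriorParam (hρ : 0 < ρ) (hp : 0 < p) (hx : ρ * (1 + p) ^ 2 < x) :
    HasDerivAt (exteriorParam ρ p) (-exteriorParam ρ p x /
      √((x - ρ * (1 - p) ^ 2) * (x - ρ * (1 + p) ^ 2))) x := by
  have hpos : 0 < (x - ρ * (1 - p) ^ 2) * (x - ρ * (1 + p) ^ 2) :=
    mul_pos (by nlinarith [mul_pos hρ hp]) (by linarith)
  have hS0 := sqrt_pos.2 hpos
  have h1 := (((hasDerivAt_id x).sub_const (ρ * (1 - p) ^ 2)).mul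
    ((hasDerivAt_id x).sub_const (ρ * (1 + p) ^ 2))).sqrt hpos.ne'
  have h2 := ((((hasDerivAt_id x).sub_const (ρ * (1 + p ^ 2))).sub h1).div_const (2 * ρ * p))
  refine h2.congr_deriv ?_
  simp only [id, exteriorParam, Pi.mul_apply]
  generalize √((x - ρ * (1 - p) ^ 2) * (x - ρ * (1 + p) ^ 2)) = S at *
  field_simp
  ring

lemma hasDerivAt_exteriorPotential (hρ : 0 < ρ) (hp : 0 < p)
    (hx : ρ * (1 + p) ^ 2 < x) :
    HasDerivAt (fun x => x - ρ * (1 - p ^ 2) * log x -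
        2 * ρ * exteriorPotential ρ p (exteriorParam ρ p x))
      (√((x - ρ * (1 - p) ^ 2) * (x - ρ * (1 + p) ^ 2)) / x) x := by
  have hQ := exteriorParam_pos hρ hp hx.le
  have hQ1 := exteriorParam_lt_one hρ hp hx
  have hx0 : 0 < x := lt_trans (by positivity) hx
  have hd := hasDerivAt_exteriorParam hρ hp hx
  have h1 := ((hasDerivAt_const x (ρ * p)).div hd hQ.ne').log (div_pos (mul_pos hρ hp) hQ).ne'
  have h2 := ((hd.const_mul p).const_add 1).log
    (add_pos one_pos (mul_pos hp hQ)).ne'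
  have h3 := ((h1.const_mul (p ^ 2)).add (hd.const_mul p)).sub (h2.const_mul (1 - p ^ 2))
  have h4 := ((hasDerivAt_id x).sub ((hasDerivAt_log hx0.ne').const_mul (ρ * (1 - p ^ 2)))).sub
    (h3.const_mul (2 * ρ))
  refine h4.congr_deriv ?_
  have hxe := eq_exteriorParam hρ hp hx.le
  simp only [Pi.div_apply]
  rw [sqrt_eq_exteriorParam hρ hp hx.le]
  clear h4 h3 h2 h1 hd
  generalize exteriorParam ρ p x = Q at *
  have hQ2 : 1 - Q ^ 2 ≠ 0 := by nlinarith
  have hS : ρ * p * (1 / Q - Q) = ρ * p * (1 - Q ^ 2) / Q := by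
    field_simp
  have hxQ : x = ρ * (1 + p * Q) * (Q + p) / Q := by
    rw [← hxe]
    field_simp
  rw [hS, hxQ]
  field_simp
  ring

lemma integral_sqrt_div_eq_exteriorPotential (hρ : 0 < ρ) (hp : 0 < p)
    (hx : ρ * (1 + p) ^ 2 ≤ x) :
    ∫ t in Ioo (ρ * (1 + p) ^ 2) x, √((t - ρ * (1 - p) ^ 2) * (t - ρ * (1 + p) ^ 2)) / t =
      (x - ρ * (1 - p ^ 2) * log x - 2 * ρ * exteriorPotential ρ p (exteriorParam ρ p x)) -
      (ρ * (1 + p) ^ 2 - ρ * (1 - p ^ 2) * log (ρ * (1 + p) ^ 2)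
        - 2 * ρ * exteriorPotential ρ p 1) := by
  have hb : 0 < ρ * (1 + p) ^ 2 := by positivity
  have hpos : ∀ t ∈ Icc (ρ * (1 + p) ^ 2) x, t ≠ 0 := fun t ht => (hb.trans_le ht.1).ne'
  rw [← integral_Ioc_eq_integral_Ioo, ← intervalIntegral.integral_of_le hx]
  have h := intervalIntegral.integral_eq_sub_of_hasDerivAt_of_le hx
    (f := fun x => x - ρ * (1 - p ^ 2) * log x -
        2 * ρ * exteriorPotential ρ p (exteriorParam ρ p x))
    ((continuousOn_id.sub ((continuousOn_id.log hpos).const_smul (ρ * (1 - p ^ 2)))).sub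
      (((continuousOn_exteriorPotential hρ hp).mono Icc_subset_Ici_self).const_smul (2 * ρ)))
    (fun t ht => hasDerivAt_exteriorPotential hρ hp ht.1)
    (ContinuousOn.intervalIntegrable_of_Icc hx
      (ContinuousOn.div (by fun_prop) continuousOn_id hpos))
  rw [h, exteriorParam_right hρ hp]

lemma integral_log_mul_density_eq_exteriorPotential (hρ : 0 < ρ) (hp : 0 < p) (hp1 : p < 1)
    (hx : ρ * (1 + p) ^ 2 ≤ x) :
    ∫ t in Ioo (ρ * (1 - p) ^ 2) (ρ * (1 + p) ^ 2),
      log (1 / (x - t)) * (√((t - ρ * (1 - p) ^ 2) * (ρ * (1 + p) ^ 2 - t)) / t) =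
      -(2 * π * ρ * exteriorPotential ρ p (exteriorParam ρ p x)) := by
  have hlt : ∀ y, ρ * (1 + p) ^ 2 < y →
      ∫ t in Ioo (ρ * (1 - p) ^ 2) (ρ * (1 + p) ^ 2),
        log (1 / (y - t)) * (√((t - ρ * (1 - p) ^ 2) * (ρ * (1 + p) ^ 2 - t)) / t) =
      -(2 * π * ρ * exteriorPotential ρ p (exteriorParam ρ p y)) := fun y hy => by
    have h := integral_log_mul_density hρ hp hp1 (exteriorParam_pos hρ hp hy.le)
      (exteriorParam_lt_one hρ hp hy)
    rwa [eq_exteriorParam hρ hp hy.le] at h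
  rcases hx.eq_or_lt with rfl | hx
  · have h1 := continuousWithinAt_integral_log_mul_density (a := ρ * (1 - p) ^ 2)
      (b := ρ * (1 + p) ^ 2) (mul_pos hρ (pow_pos (by linarith) 2)) (by nlinarith [mul_pos hρ hp])
    have h2 : ContinuousWithinAt
        (fun x => -(2 * π * ρ * exteriorPotential ρ p (exteriorParam ρ p x)))
        (Ioi (ρ * (1 + p) ^ 2)) (ρ * (1 + p) ^ 2) :=
      ((((continuousOn_exteriorPotential hρ hp) _ self_mem_Ici).mono
        Ioi_subset_Ici_self).const_smul (2 * π * ρ)).neg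
    exact tendsto_nhds_unique_of_eventuallyEq h1 h2 (eventually_mem_nhdsWithin.mono hlt)
  · exact hlt x hx

end

/-- Logarithmic potential of the measure with density `(1/(2π))√((t−a)(b−t))/t` on `[a,b]`:
for `x ≥ b`,
`U(x) = −(1/2)(x − √(ab) log x) + C_μ + (1/2)∫_b^x √((t−a)(t−b))/t dt`, where
`C_μ = (1/4)(a+b)(1 − log((b−a)/4)) − (√(ab)/2) log((√b+√a)/(√b−√a))`. -/
theorem potential_formula (a b : ℝ) (ha : 0 < a) (hab : a < b) (x : ℝ) (hx : b ≤ x) :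
    (1 / (2 * Real.pi)) *
        ∫ t in Set.Ioo a b, Real.log (1 / (x - t)) * (Real.sqrt ((t - a) * (b - t)) / t) =
      -(1 / 2) * (x - Real.sqrt (a * b) * Real.log x) +
        ((1 / 4) * (a + b) * (1 - Real.log ((b - a) / 4)) -
          (Real.sqrt (a * b) / 2) *
            Real.log ((Real.sqrt b + Real.sqrt a) / (Real.sqrt b - Real.sqrt a))) +
        (1 / 2) * ∫ t in Set.Ioo b x, Real.sqrt ((t - a) * (t - b)) / t := by
  have hsa : 0 < √a := sqrt_pos.2 ha
  have hsab : √a < √b := sqrt_lt_sqrt ha.le hab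
  obtain ⟨s, p, hs, hp, hp1, h1, h2⟩ : ∃ s p : ℝ, 0 < s ∧ 0 < p ∧ p < 1 ∧
      √a = s * (1 - p) ∧ √b = s * (1 + p) := by
    have hsum : 0 < √b + √a := by linarith
    refine ⟨(√b + √a) / 2, (√b - √a) / (√b + √a), by positivity, div_pos (by linarith) hsum,
      (div_lt_one hsum).2 (by linarith), ?_, ?_⟩ <;> field_simp <;> ring
  have hρ : 0 < s ^ 2 := by positivity
  have hae : a = s ^ 2 * (1 - p) ^ 2 := by rw [← sq_sqrt ha.le, h1]; ring
  have hbe : b = s ^ 2 * (1 + p) ^ 2 := by rw [← sq_sqrt (ha.trans hab).le, h2]; ring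
  have hratio : (√b + √a) / (√b - √a) = p⁻¹ := by
    rw [h1, h2, show s * (1 + p) + s * (1 - p) = 2 * s by ring,
      show s * (1 + p) - s * (1 - p) = 2 * s * p by ring]
    field_simp
  have hgeom : √(a * b) = s ^ 2 * (1 - p ^ 2) := by
    rw [sqrt_mul ha.le, h1, h2]
    ring
  rw [hratio, hgeom]
  generalize s ^ 2 = ρ at *
  subst hae hbe
  rw [integral_log_mul_density_eq_exteriorPotential hρ hp hp1 hx,
    integral_sqrt_div_eq_exteriorPotential hρ hp hx,
    show (ρ * (1 + p) ^ 2 - ρ * (1 - p) ^ 2) / 4 = ρ * p by ring]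
  simp only [exteriorPotential, div_one, mul_one]
  have hp' : (1 + p) ^ 2 ≠ 0 := by positivity
  rw [log_mul hρ.ne' hp', log_mul hρ.ne' hp.ne', log_pow, log_inv]
  push_cast
  field_simp
  ring
end

section
/- Let 0 < a < b. Then as x → +∞, ∫_b^x √((t−a)(t−b)) dt − x²/2 + ((a+b)/2)·x + ((b−a)²/8)·log x converges to (1/16)·(a² + 6ab + b² + 2(b−a)²·log((b−a)/4)). -/
open Filter Topology

/-- An antiderivative of `√((t - a) * (t - b))` for `t > b`. -/
noncomputable def sqrtQuadraticPrimitive (a b t : ℝ) : ℝ :=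
  (t - (a + b) / 2) * √((t - a) * (t - b)) / 2 -
    (b - a) ^ 2 / 8 * Real.log (t - (a + b) / 2 + √((t - a) * (t - b)))

theorem hasDerivAt_sqrtQuadraticPrimitive {a b t : ℝ} (hab : a < b) (ht : b < t) :
    HasDerivAt (sqrtQuadraticPrimitive a b) (√((t - a) * (t - b))) t := by
  have hpos : 0 < (t - a) * (t - b) := mul_pos (by linarith) (by linarith)
  have hs : 0 < √((t - a) * (t - b)) := Real.sqrt_pos.2 hpos
  have hsq : √((t - a) * (t - b)) ^ 2 = (t - a) * (t - b) := Real.sq_sqrt hpos.le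
  have hu : HasDerivAt (fun y : ℝ => y - (a + b) / 2) 1 t := (hasDerivAt_id t).sub_const _
  have hsqrt := (((hasDerivAt_id t).sub_const a).mul ((hasDerivAt_id t).sub_const b)).sqrt
    hpos.ne'
  have hne : t - (a + b) / 2 + √((t - a) * (t - b)) ≠ 0 := by
    have : 0 < t - (a + b) / 2 := by linarith
    positivity
  have h := ((hu.mul hsqrt).div_const 2).sub
    (((hu.add hsqrt).log hne).const_mul ((b - a) ^ 2 / 8))
  refine h.congr_deriv ?_
  simp only [id, Pi.mul_apply, Pi.add_apply]
  set s := √((t - a) * (t - b))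
  have hlog : (1 + (1 * (t - b) + (t - a) * 1) / (2 * s)) / (t - (a + b) / 2 + s) = 1 / s := by
    rw [div_eq_div_iff hne hs.ne']
    field_simp
    ring
  rw [hlog]
  field_simp
  linear_combination (-32) * hsq

theorem continuousOn_sqrtQuadraticPrimitive {a b : ℝ} (hab : a < b) :
    ContinuousOn (sqrtQuadraticPrimitive a b) (Set.Ici b) := by
  have hs : Continuous fun t : ℝ => √((t - a) * (t - b)) := by fun_prop
  have hu : Continuous fun t : ℝ => t - (a + b) / 2 := by fun_prop
  refine ContinuousOn.sub ((hu.mul hs).div_const 2).continuousOn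
    (continuousOn_const.mul ((hu.add hs).continuousOn.log fun t ht => ?_))
  have : 0 < t - (a + b) / 2 := by linarith [Set.mem_Ici.1 ht]
  exact (add_pos_of_pos_of_nonneg this (Real.sqrt_nonneg _)).ne'

theorem setIntegral_Ioo_sqrt_quadratic {a b x : ℝ} (hab : a < b) (hx : b ≤ x) :
    ∫ t in Set.Ioo b x, √((t - a) * (t - b)) =
      sqrtQuadraticPrimitive a b x - sqrtQuadraticPrimitive a b b := by
  rw [← MeasureTheory.integral_Ioc_eq_integral_Ioo, ← intervalIntegral.integral_of_le hx]
  have hs : Continuous fun t : ℝ => √((t - a) * (t - b)) := by fun_prop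
  exact intervalIntegral.integral_eq_sub_of_hasDerivAt_of_le hx
    ((continuousOn_sqrtQuadraticPrimitive hab).mono Set.Icc_subset_Ici_self)
    (fun t ht => hasDerivAt_sqrtQuadraticPrimitive hab ht.1) (hs.intervalIntegrable _ _)

theorem tendsto_one_sub_div_atTop (c : ℝ) : Tendsto (fun x : ℝ => 1 - c / x) atTop (𝓝 1) := by
  simpa using (tendsto_const_nhds (x := (1 : ℝ))).sub (tendsto_id.const_div_atTop c)

theorem tendsto_sqrt_quadratic_div_atTop (a b : ℝ) :
    Tendsto (fun x : ℝ => √((x - a) * (x - b)) / x) atTop (𝓝 1) := by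
  have h := ((tendsto_one_sub_div_atTop a).mul (tendsto_one_sub_div_atTop b)).sqrt
  rw [mul_one, Real.sqrt_one] at h
  refine h.congr' ?_
  filter_upwards [eventually_gt_atTop 0] with x hx
  have : (1 - a / x) * (1 - b / x) = (x - a) * (x - b) / x ^ 2 := by field_simp
  rw [this, Real.sqrt_div' _ (sq_nonneg x), Real.sqrt_sq hx.le]

/-- As `x → +∞`,
`∫_b^x √((t−a)(t−b)) dt − x²/2 + ((a+b)/2)x + ((b−a)²/8) log x →
  (1/16)(a² + 6ab + b² + 2(b−a)² log((b−a)/4))`. -/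
theorem asymptotic_I1 (a b : ℝ) (ha : 0 < a) (hab : a < b) :
    Tendsto
      (fun x : ℝ =>
        (∫ t in Set.Ioo b x, Real.sqrt ((t - a) * (t - b))) - x ^ 2 / 2 +
          ((a + b) / 2) * x + ((b - a) ^ 2 / 8) * Real.log x)
      atTop
      (𝓝 ((1 / 16) *
        (a ^ 2 + 6 * a * b + b ^ 2 + 2 * (b - a) ^ 2 * Real.log ((b - a) / 4)))) := by
  have hu : Tendsto (fun x : ℝ => (x - (a + b) / 2) / x) atTop (𝓝 1) := by
    refine (tendsto_one_sub_div_atTop ((a + b) / 2)).congr' ?_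
    filter_upwards [eventually_gt_atTop 0] with x hx
    field_simp
  have hw : Tendsto (fun x : ℝ => (x - (a + b) / 2 + √((x - a) * (x - b))) / x) atTop (𝓝 2) := by
    have h := hu.add (tendsto_sqrt_quadratic_div_atTop a b)
    rw [one_add_one_eq_two] at h
    exact h.congr fun x => (add_div _ _ _).symm
  have hlim := (((hu.div hw two_ne_zero).const_mul (-(b - a) ^ 2 / 8)).sub
    ((hw.log two_ne_zero).const_mul ((b - a) ^ 2 / 8))).add_const
    ((a + b) ^ 2 / 8 + (b - a) ^ 2 / 8 * Real.log ((b - a) / 2))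
  have hlog : Real.log ((b - a) / 4) = Real.log ((b - a) / 2) - Real.log 2 := by
    rw [← Real.log_div (by linarith) two_ne_zero]
    congr 1
    ring
  have hval : (1 / 16) *
      (a ^ 2 + 6 * a * b + b ^ 2 + 2 * (b - a) ^ 2 * Real.log ((b - a) / 4)) =
      -(b - a) ^ 2 / 8 * (1 / 2) - (b - a) ^ 2 / 8 * Real.log 2 +
        ((a + b) ^ 2 / 8 + (b - a) ^ 2 / 8 * Real.log ((b - a) / 2)) := by
    rw [hlog]
    ring
  rw [hval]
  refine hlim.congr' ?_
  filter_upwards [eventually_gt_atTop b] with x hx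
  have hx0 : 0 < x := by linarith
  have hm : 0 < x - (a + b) / 2 := by linarith
  have hsq : √((x - a) * (x - b)) ^ 2 = (x - a) * (x - b) :=
    Real.sq_sqrt (mul_nonneg (by linarith) (by linarith))
  have hb : sqrtQuadraticPrimitive a b b = -((b - a) ^ 2 / 8 * Real.log ((b - a) / 2)) := by
    have : b - (a + b) / 2 = (b - a) / 2 := by ring
    simp [sqrtQuadraticPrimitive, this]
  rw [setIntegral_Ioo_sqrt_quadratic hab hx.le, hb, sqrtQuadraticPrimitive]
  set s := √((x - a) * (x - b))
  have hs : 0 ≤ s := Real.sqrt_nonneg _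
  have hw0 : x - (a + b) / 2 + s ≠ 0 := by positivity
  have hquot : (x - (a + b) / 2) / x / ((x - (a + b) / 2 + s) / x) =
      (x - (a + b) / 2) / (x - (a + b) / 2 + s) := div_div_div_cancel_right₀ hx0.ne' _ _
  have hrat : -(b - a) ^ 2 / 8 * ((x - (a + b) / 2) / (x - (a + b) / 2 + s)) =
      (x - (a + b) / 2) * (s - (x - (a + b) / 2)) / 2 := by
    rw [mul_div_assoc', div_eq_iff hw0]
    linear_combination (-(x - (a + b) / 2) / 2) * hsq
  simp only [Pi.div_apply]
  rw [hquot, hrat, Real.log_div hw0 hx0.ne']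
  ring
end

section
/- Let 0 < a < b. Then as x → +∞, ∫_b^x √((t−b)/(t−a)) dt − x + ((b−a)/2)·log x converges to −(a+b)/2 + ((b−a)/2)·log((b−a)/4). -/
open Filter Topology

theorem hasDerivAt_sqrt_mul_sqrt_sub_log {a b t : ℝ} (hab : a < b) (ht : b < t) :
    HasDerivAt
      (fun t : ℝ => √(t - a) * √(t - b) - (b - a) * Real.log (√(t - a) + √(t - b)))
      (√((t - b) / (t - a))) t := by
  have hu : 0 < √(t - a) := Real.sqrt_pos.2 (by linarith)
  have hv : 0 < √(t - b) := Real.sqrt_pos.2 (by linarith)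
  have hu2 : √(t - a) ^ 2 = t - a := Real.sq_sqrt (by linarith)
  have hv2 : √(t - b) ^ 2 = t - b := Real.sq_sqrt (by linarith)
  have du := ((hasDerivAt_id t).sub_const a).sqrt (sub_ne_zero.2 (hab.trans ht).ne')
  have dv := ((hasDerivAt_id t).sub_const b).sqrt (sub_ne_zero.2 ht.ne')
  simp only [id] at du dv
  refine ((du.mul dv).sub
    (((du.add dv).log (add_pos hu hv).ne').const_mul (b - a))).congr_deriv ?_
  rw [Real.sqrt_div (by linarith), show b - a = √(t - a) ^ 2 - √(t - b) ^ 2 by linarith]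
  simp only [Pi.add_apply]
  generalize √(t - a) = u at *
  generalize √(t - b) = v at *
  have := (add_pos hu hv).ne'
  field_simp
  ring

theorem integral_sqrt_div_sub {a b x : ℝ} (hab : a < b) (hx : b ≤ x) :
    ∫ t in Set.Ioo b x, √((t - b) / (t - a)) =
      √(x - a) * √(x - b) - (b - a) * Real.log (√(x - a) + √(x - b))
        + (b - a) / 2 * Real.log (b - a) := by
  rw [← MeasureTheory.integral_Ioc_eq_integral_Ioo, ← intervalIntegral.integral_of_le hx,
    intervalIntegral.integral_eq_sub_of_hasDerivAt_of_le hx ?_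
      (fun t ht => hasDerivAt_sqrt_mul_sqrt_sub_log hab ht.1) ?_]
  · simp only [sub_self, Real.sqrt_zero, mul_zero, add_zero]
    rw [Real.log_sqrt (by linarith)]
    ring
  · refine ContinuousOn.sub (by fun_prop) (continuousOn_const.mul (ContinuousOn.log (by fun_prop) ?_))
    intro t ht
    have : 0 < √(t - a) := Real.sqrt_pos.2 (by linarith [ht.1])
    positivity
  · apply ContinuousOn.intervalIntegrable_of_Icc hx
    refine (ContinuousOn.div (by fun_prop) (by fun_prop) ?_).sqrt
    intro t ht
    linarith [ht.1]

theorem tendsto_sqrt_one_sub_div_atTop (c : ℝ) :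
    Tendsto (fun x : ℝ => √(1 - c / x)) atTop (𝓝 1) := by
  simpa using ((tendsto_const_nhds (x := (1 : ℝ))).sub
    ((tendsto_const_nhds (x := c)).div_atTop tendsto_id)).sqrt

theorem sqrt_sub_eq_sqrt_mul {c x : ℝ} (hx : 0 < x) : √(x - c) = √x * √(1 - c / x) := by
  rw [← Real.sqrt_mul hx.le]
  congr 1
  field_simp

/-- As `x → +∞`,
`∫_b^x √((t−b)/(t−a)) dt − x + ((b−a)/2) log x → −(a+b)/2 + ((b−a)/2) log((b−a)/4)`. -/
theorem asymptotic_I2 (a b : ℝ) (ha : 0 < a) (hab : a < b) :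
    Tendsto
      (fun x : ℝ =>
        (∫ t in Set.Ioo b x, Real.sqrt ((t - b) / (t - a))) - x +
          ((b - a) / 2) * Real.log x)
      atTop
      (𝓝 (-(a + b) / 2 + ((b - a) / 2) * Real.log ((b - a) / 4))) := by
  have hp := tendsto_sqrt_one_sub_div_atTop a
  have hq := tendsto_sqrt_one_sub_div_atTop b
  have hr : Tendsto (fun x : ℝ => -(a + b) + a * b / x) atTop (𝓝 (-(a + b) + 0)) :=
    tendsto_const_nhds.add ((tendsto_const_nhds (x := a * b)).div_atTop tendsto_id)
  have hlim := ((hr.div ((hp.mul hq).add_const 1) (by norm_num)).sub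
    (((hp.add hq).log (by norm_num)).const_mul (b - a))).add_const
      ((b - a) / 2 * Real.log (b - a))
  have hlog4 : Real.log 4 = 2 * Real.log 2 := by
    rw [show (4 : ℝ) = 2 ^ 2 by norm_num, Real.log_pow]
    norm_num
  have hval : -(a + b) / 2 + (b - a) / 2 * Real.log ((b - a) / 4) =
      (-(a + b) + 0) / (1 * 1 + 1) - (b - a) * Real.log (1 + 1)
        + (b - a) / 2 * Real.log (b - a) := by
    rw [Real.log_div (by linarith) (by norm_num), hlog4, one_add_one_eq_two]
    ring_nf
  rw [hval]
  refine hlim.congr' ?_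
  filter_upwards [eventually_gt_atTop b] with x hx
  have hx0 : 0 < x := by linarith
  have hp0 : 0 < √(1 - a / x) :=
    Real.sqrt_pos.2 (sub_pos.2 ((div_lt_one hx0).2 (hab.trans hx)))
  have hq0 : 0 < √(1 - b / x) := Real.sqrt_pos.2 (sub_pos.2 ((div_lt_one hx0).2 hx))
  have hp2 : √(1 - a / x) ^ 2 = 1 - a / x := Real.sq_sqrt (Real.sqrt_pos.1 hp0).le
  have hq2 : √(1 - b / x) ^ 2 = 1 - b / x := Real.sq_sqrt (Real.sqrt_pos.1 hq0).le
  have hs2 : √x ^ 2 = x := Real.sq_sqrt hx0.le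
  have hdiff : (-(a + b) + a * b / x) / (√(1 - a / x) * √(1 - b / x) + 1) =
      x * (√(1 - a / x) * √(1 - b / x)) - x := by
    rw [div_eq_iff (by positivity)]
    have : x * (√(1 - a / x) ^ 2 * √(1 - b / x) ^ 2 - 1) = -(a + b) + a * b / x := by
      rw [hp2, hq2]
      field_simp
      ring
    linear_combination -this
  simp only [Pi.div_apply]
  rw [integral_sqrt_div_sub hab hx.le, sqrt_sub_eq_sqrt_mul hx0, sqrt_sub_eq_sqrt_mul hx0,
    ← mul_add, Real.log_mul (Real.sqrt_pos.2 hx0).ne' (add_pos hp0 hq0).ne',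
    Real.log_sqrt hx0.le, hdiff]
  linear_combination -(√(1 - a / x) * √(1 - b / x)) * hs2
end

section
/- Let α ≥ 0 and 0 < a < b with ψ_α(b, a) = 0 and φ_α(b, a) ≥ 0, and define U(x) = ∫_a^b log(1/|x−t|)·f_{α,a,b}(t) dt for x > 0. Then there exists a constant C ∈ ℝ such that: (i) U(x) + (1/2)Q_α(x) = C for all x ∈ [a, b]; (ii) U(x) + (1/2)Q_α(x) ≥ C for all x ≥ b; and (iii) if moreover φ_α(b, a) = 0, then U(x) + (1/2)Q_α(x) ≥ C for all x ∈ (0, a]. -/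
/-- External field `Q_α(x) = x² − 2α log x`. -/
noncomputable def extQ (α x : ℝ) : ℝ := x ^ 2 - 2 * α * Real.log x

/-- Logarithmic potential `U(x) = ∫_a^b log(1/|x−t|) f_{α,a,b}(t) dt`. -/
noncomputable def potU (α a b x : ℝ) : ℝ :=
  ∫ t in Set.Ioo a b, Real.log (1 / |x - t|) * densF α a b t

open Metric InnerProductSpace
/-- A trigonometric polynomial of degree two plus a multiple of a Poisson kernel. -/
noncomputable def circleWeight (A₀ A₁ A₂ B : ℝ) (p z : ℂ) : ℝ :=
  A₀ + A₁ * z.re + A₂ * (z ^ 2).re + B * poissonKernel 0 p z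

lemma DiffContOnCl.circleAverage_mul_re_pow {F : ℂ → ℂ} (hF : DiffContOnCl ℂ F (ball 0 1))
    (n : ℕ) (hn : n ≠ 0) :
    Real.circleAverage (fun z ↦ F z * ((z ^ n).re : ℂ)) 0 1 =
      iteratedDeriv n F 0 / (2 * n.factorial) := by
  have hcont : ContinuousOn F (sphere 0 |1|) :=
    hF.continuousOn_ball.mono (by simpa using sphere_subset_closedBall)
  have hne : ∀ z ∈ sphere (0 : ℂ) |1|, z ≠ 0 := by
    rintro z hz rfl; simp at hz
  have hpos : Real.circleAverage (fun z ↦ F z * z ^ n) 0 1 = 0 := by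
    have := DiffContOnCl.circleAverage (R := 1) (c := 0) (f := fun z ↦ z ^ n • F z)
      ((Differentiable.diffContOnCl (by fun_prop)).smul (by simpa using hF))
    simpa [hn, mul_comm] using this
  have hneg : Real.circleAverage (fun z ↦ F z * (z ^ n)⁻¹) 0 1 =
      iteratedDeriv n F 0 / n.factorial := by
    rw [Real.circleAverage_eq_circleIntegral one_ne_zero]
    have h := hF.circleIntegral_one_div_sub_center_pow_smul one_pos n
    have : (∮ z in C((0 : ℂ), 1), (z - 0)⁻¹ • (F z * (z ^ n)⁻¹)) =
        ∮ z in C((0 : ℂ), 1), (1 / (z - 0) ^ (n + 1)) • F z := by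
      congr 1; ext z; simp [pow_succ]; ring
    rw [this, h, smul_smul, smul_eq_mul]
    have := Complex.two_pi_I_ne_zero
    field_simp
  have key : Real.circleAverage (fun z ↦ F z * ((z ^ n).re : ℂ)) 0 1 =
      Real.circleAverage (fun z ↦ (2⁻¹ : ℂ) • (F z * z ^ n + F z * (z ^ n)⁻¹)) 0 1 := by
    refine Real.circleAverage_congr_sphere fun z hz ↦ ?_
    have hz1 : ‖z ^ n‖ = 1 := by
      rw [norm_pow, show ‖z‖ = 1 by simpa using hz, one_pow]
    simp only [smul_eq_mul]
    rw [Complex.inv_def (z ^ n), Complex.normSq_eq_norm_sq, hz1, Complex.re_eq_add_conj]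
    simp; ring
  rw [key, Real.circleAverage_fun_smul, Real.circleAverage_fun_add, hpos, hneg]
  · simp; ring
  · exact ContinuousOn.circleIntegrable' (by fun_prop)
  · exact ContinuousOn.circleIntegrable' (hcont.mul (ContinuousOn.inv₀ (by fun_prop)
      fun z hz ↦ pow_ne_zero _ (hne z hz)))

lemma continuousOn_circleWeight (A₀ A₁ A₂ B : ℝ) {p : ℂ} (hp : ‖p‖ < 1) :
    ContinuousOn (circleWeight A₀ A₁ A₂ B p) (sphere 0 1) := by
  have : ContinuousOn (poissonKernel 0 p) (sphere 0 1) := by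
    refine ContinuousOn.div (by fun_prop) (by fun_prop) fun z hz ↦ ?_
    have : z - p ≠ 0 := by
      rintro h; rw [sub_eq_zero] at h; subst h
      rw [mem_sphere_zero_iff_norm] at hz; linarith
    simpa using this
  unfold circleWeight
  fun_prop

lemma DiffContOnCl.circleAverage_re_mul_circleWeight {F : ℂ → ℂ}
    (hF : DiffContOnCl ℂ F (ball 0 1)) (A₀ A₁ A₂ B : ℝ) {p : ℂ} (hp : ‖p‖ < 1) :
    Real.circleAverage (fun z ↦ (F z).re * circleWeight A₀ A₁ A₂ B p z) 0 1 =
      A₀ * (F 0).re + A₁ / 2 * (deriv F 0).re + A₂ / 4 * (iteratedDeriv 2 F 0).re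
        + B * (F p).re := by
  have hcont : ContinuousOn F (sphere 0 |1|) :=
    hF.continuousOn_ball.mono (by simpa using sphere_subset_closedBall)
  have hpk : ContinuousOn (poissonKernel 0 p) (sphere 0 |1|) := by
    have h : circleWeight 0 0 0 1 p = poissonKernel 0 p := by ext; simp [circleWeight]
    simpa [h] using continuousOn_circleWeight 0 0 0 1 hp
  have h0 : Real.circleAverage F 0 1 = F 0 :=
    DiffContOnCl.circleAverage (by simpa using hF)
  have h1 := hF.circleAverage_mul_re_pow 1 one_ne_zero
  have h2 := hF.circleAverage_mul_re_pow 2 two_ne_zero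
  have h3 := hF.circleAverage_poissonKernel_smul (w := p) (by simpa using hp)
  have hpk' : ContinuousOn (fun z ↦ (poissonKernel 0 p z : ℂ)) (sphere 0 |1|) :=
    Complex.continuous_ofReal.comp_continuousOn hpk
  have hsum : Real.circleAverage (fun z ↦ F z * (circleWeight A₀ A₁ A₂ B p z : ℂ)) 0 1 =
      (A₀ : ℂ) * F 0 + A₁ * (iteratedDeriv 1 F 0 / (2 * Nat.factorial 1))
        + A₂ * (iteratedDeriv 2 F 0 / (2 * Nat.factorial 2)) + B * F p := by
    rw [← h0, ← h1, ← h2, ← h3]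
    simp only [← smul_eq_mul (a := (A₀ : ℂ)), ← smul_eq_mul (a := (A₁ : ℂ)),
      ← smul_eq_mul (a := (A₂ : ℂ)), ← smul_eq_mul (a := (B : ℂ)), ← Real.circleAverage_fun_smul]
    rw [← Real.circleAverage_fun_add, ← Real.circleAverage_fun_add, ← Real.circleAverage_fun_add]
    · congr 1; ext z; simp [circleWeight]; ring
    all_goals exact ContinuousOn.circleIntegrable' (by
      simp only [Pi.smul_apply', Complex.real_smul, smul_eq_mul]; fun_prop)
  have hre := Complex.reCLM.circleAverage_comp_comm (c := 0) (R := 1)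
    (f := fun z ↦ F z * (circleWeight A₀ A₁ A₂ B p z : ℂ))
    (ContinuousOn.circleIntegrable' (hcont.mul (Complex.continuous_ofReal.comp_continuousOn
      (by simpa using continuousOn_circleWeight A₀ A₁ A₂ B hp))))
  rw [hsum] at hre
  convert hre using 1
  · congr 1; ext z; simp
  · have e1 : (A₁ : ℂ) * (iteratedDeriv 1 F 0 / (2 * Nat.factorial 1)) =
        ((A₁ / 2 : ℝ) : ℂ) * deriv F 0 := by simp; ring
    have e2 : (A₂ : ℂ) * (iteratedDeriv 2 F 0 / (2 * Nat.factorial 2)) =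
        ((A₂ / 4 : ℝ) : ℂ) * iteratedDeriv 2 F 0 := by simp; ring
    rw [e1, e2]
    simp only [Complex.reCLM_apply, Complex.add_re, Complex.re_ofReal_mul]

lemma circleAverage_log_norm_mul_circleWeight_of_lt (A₀ A₁ A₂ B k : ℝ) {p w : ℂ} (hp : ‖p‖ < 1)
    (hw : ‖w‖ < 1) :
    Real.circleAverage (fun z ↦ (k + Real.log ‖1 - w * z‖) * circleWeight A₀ A₁ A₂ B p z) 0 1 =
      (A₀ + B) * k - A₁ / 2 * w.re - A₂ / 4 * (w ^ 2).re + B * Real.log ‖1 - w * p‖ := by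
  have hslit : ∀ z ∈ closedBall (0 : ℂ) 1, 1 - w * z ∈ Complex.slitPlane := by
    intro z hz
    left
    have h1 : ‖w * z‖ < 1 := by
      rw [norm_mul]
      exact (mul_le_of_le_one_right (norm_nonneg _) (by simpa using hz)).trans_lt hw
    have h2 := Complex.re_le_norm (w * z)
    rw [Complex.sub_re, Complex.one_re]; linarith
  have hd : ∀ z ∈ closedBall (0 : ℂ) 1,
      HasDerivAt (fun z ↦ (k : ℂ) + Complex.log (1 - w * z)) (-w / (1 - w * z)) z := by
    intro z hz
    have h : HasDerivAt (fun z ↦ 1 - w * z) (-w) z := by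
      simpa using ((hasDerivAt_id z).const_mul w).const_sub 1
    exact (h.clog (hslit z hz)).const_add _
  have hF : DiffContOnCl ℂ (fun z ↦ (k : ℂ) + Complex.log (1 - w * z)) (ball 0 1) := by
    refine DifferentiableOn.diffContOnCl fun z hz ↦ ?_
    exact (hd z (closure_ball_subset_closedBall hz)).differentiableAt.differentiableWithinAt
  have hd1 : deriv (fun z ↦ (k : ℂ) + Complex.log (1 - w * z)) 0 = -w := by
    simpa using (hd 0 (by simp)).deriv
  have hd2 : iteratedDeriv 2 (fun z ↦ (k : ℂ) + Complex.log (1 - w * z)) 0 = -w ^ 2 := by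
    rw [iteratedDeriv_succ, iteratedDeriv_one]
    have hev : deriv (fun z ↦ (k : ℂ) + Complex.log (1 - w * z)) =ᶠ[nhds 0]
        fun z ↦ -w / (1 - w * z) := by
      filter_upwards [closedBall_mem_nhds (0 : ℂ) one_pos] with z hz using (hd z hz).deriv
    rw [hev.deriv_eq]
    have h : HasDerivAt (fun z ↦ 1 - w * z) (-w) 0 := by
      simpa using ((hasDerivAt_id (0 : ℂ)).const_mul w).const_sub 1
    have := (hasDerivAt_const (0 : ℂ) (-w)).div h (by simp)
    rw [show (fun z ↦ -w / (1 - w * z)) = (fun _ ↦ -w) / (fun z ↦ 1 - w * z) from rfl, this.deriv]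
    simp; ring
  have := hF.circleAverage_re_mul_circleWeight A₀ A₁ A₂ B hp
  simp only [hd1, hd2, Complex.add_re, Complex.ofReal_re, Complex.log_re] at this
  rw [this]
  simp
  ring

open Filter Topology in
lemma circleAverage_log_norm_mul_circleWeight (A₀ A₁ A₂ B k : ℝ) {p w : ℂ} (hp : ‖p‖ < 1)
    (hw : ‖w‖ ≤ 1) :
    Real.circleAverage (fun z ↦ (k + Real.log ‖1 - w * z‖) * circleWeight A₀ A₁ A₂ B p z) 0 1 =
      (A₀ + B) * k - A₁ / 2 * w.re - A₂ / 4 * (w ^ 2).re + B * Real.log ‖1 - w * p‖ := by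
  rcases hw.lt_or_eq with hw | hw
  · exact circleAverage_log_norm_mul_circleWeight_of_lt A₀ A₁ A₂ B k hp hw
  have hwcont := continuousOn_circleWeight A₀ A₁ A₂ B hp
  obtain ⟨M, hM⟩ := (isCompact_sphere (0 : ℂ) 1).exists_bound_of_continuousOn hwcont
  have hwcirc : Continuous fun θ ↦ circleWeight A₀ A₁ A₂ B p (circleMap 0 1 θ) :=
    hwcont.comp_continuous (continuous_circleMap 0 1) fun θ ↦ by simp
  have hlogint : CircleIntegrable (fun z ↦ Real.log ‖1 - w * z‖) 0 1 :=
    MeromorphicOn.circleIntegrable_log_norm (f := fun z ↦ 1 - w * z) fun z _ ↦ by fun_prop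
  have hne : ∀ᵐ θ : ℝ, 1 - w * circleMap 0 1 θ ≠ 0 := by
    have hc : (circleMap 0 1 ⁻¹' {w⁻¹}).Countable :=
      (Set.countable_singleton w⁻¹).preimage_circleMap 0 one_ne_zero
    filter_upwards [hc.ae_notMem MeasureTheory.volume] with θ hθ h
    exact hθ (eq_inv_of_mul_eq_one_right (sub_eq_zero.1 h).symm)
  have hlim : Tendsto (fun s : ℝ ↦ Real.circleAverage (fun z ↦
      (k + Real.log ‖1 - (s * w) * z‖) * circleWeight A₀ A₁ A₂ B p z) 0 1) (𝓝[<] 1)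
      (𝓝 (Real.circleAverage (fun z ↦
      (k + Real.log ‖1 - w * z‖) * circleWeight A₀ A₁ A₂ B p z) 0 1)) := by
    refine Tendsto.const_smul (intervalIntegral.tendsto_integral_filter_of_dominated_convergence
      (fun θ ↦ (|k| + Real.log 2 + |Real.log ‖1 - w * circleMap 0 1 θ‖|) * M) ?_ ?_ ?_ ?_) _
    · refine Eventually.of_forall fun s ↦ ?_
      exact ((by fun_prop : Measurable fun θ ↦ k + Real.log ‖1 - (s * w) * circleMap 0 1 θ‖).mul
        hwcirc.measurable).aestronglyMeasurable
    · filter_upwards [Ioo_mem_nhdsLT (show (0 : ℝ) < 1 by norm_num)] with s hs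
      filter_upwards [hne] with θ hθ _
      have hu : ‖w * circleMap 0 1 θ‖ = 1 := by rw [norm_mul, hw]; simp
      set u := w * circleMap 0 1 θ
      rw [norm_mul, mul_assoc]
      have hnn : ‖(1 - s : ℂ)‖ = 1 - s := by
        rw [← Complex.ofReal_one, ← Complex.ofReal_sub, Complex.norm_real, Real.norm_eq_abs,
          abs_of_pos (by linarith [hs.2])]
      have hsu : ‖(s : ℂ) * u‖ = s := by
        rw [norm_mul, hu, Complex.norm_real, Real.norm_eq_abs, abs_of_pos hs.1, mul_one]
      have h1 : 1 - s ≤ ‖1 - s * u‖ := by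
        have := norm_sub_norm_le (1 : ℂ) (s * u)
        rwa [hsu, norm_one] at this
      have h2 : ‖1 - u‖ ≤ 2 * ‖1 - s * u‖ := by
        have h : ‖1 - u‖ ≤ ‖1 - s * u‖ + ‖(1 - s : ℂ) * u‖ := by
          refine le_trans (le_of_eq ?_) (norm_sub_le _ _); congr 1; ring
        rw [norm_mul, hnn, hu] at h; linarith
      have h3 : ‖1 - s * u‖ ≤ 2 := by
        have := norm_sub_le (1 : ℂ) (s * u)
        rw [hsu, norm_one] at this; linarith [hs.2]
      have hpos : 0 < ‖1 - u‖ := norm_pos_iff.2 hθ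
      have hpos' : 0 < ‖1 - s * u‖ := by linarith [hs.2]
      have h4 := Real.log_le_log hpos' h3
      have h5 := Real.log_le_log hpos h2
      rw [Real.log_mul two_ne_zero hpos'.ne'] at h5
      refine mul_le_mul ?_ (hM _ (by simp)) (norm_nonneg _) (by positivity)
      refine (norm_add_le _ _).trans ?_
      rw [Real.norm_eq_abs, add_assoc]
      gcongr
      rw [Real.norm_eq_abs, abs_le]
      constructor
      · linarith [neg_abs_le (Real.log ‖1 - u‖)]
      · linarith [abs_nonneg (Real.log ‖1 - u‖)]
    · exact (intervalIntegrable_const.add (hlogint.abs)).mul_const M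
    · filter_upwards [hne] with θ hθ _
      refine Tendsto.mul_const _ (Tendsto.const_add _ (Tendsto.log ?_ (norm_ne_zero_iff.2 hθ)))
      have : Continuous fun s : ℝ ↦ ‖1 - (s * w) * circleMap 0 1 θ‖ := by fun_prop
      simpa using this.tendsto 1 |>.mono_left nhdsWithin_le_nhds
  have hwp : ‖1 - w * p‖ ≠ 0 := by
    rw [norm_ne_zero_iff]
    intro h
    have : ‖w * p‖ < 1 := by rwa [norm_mul, hw, one_mul]
    rw [← sub_eq_zero.1 h, norm_one] at this
    exact lt_irrefl _ this
  have hlim' : Tendsto (fun s : ℝ ↦ (A₀ + B) * k - A₁ / 2 * (s * w : ℂ).re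
      - A₂ / 4 * ((s * w : ℂ) ^ 2).re + B * Real.log ‖1 - (s * w) * p‖) (𝓝[<] 1)
      (𝓝 ((A₀ + B) * k - A₁ / 2 * w.re - A₂ / 4 * (w ^ 2).re + B * Real.log ‖1 - w * p‖)) := by
    have : ContinuousAt (fun s : ℝ ↦ (A₀ + B) * k - A₁ / 2 * (s * w : ℂ).re
      - A₂ / 4 * ((s * w : ℂ) ^ 2).re + B * Real.log ‖1 - (s * w) * p‖) 1 := by
      refine ContinuousAt.add (Continuous.continuousAt (by fun_prop)) (ContinuousAt.mul
        continuousAt_const (ContinuousAt.log (Continuous.continuousAt (by fun_prop)) ?_))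
      simpa using hwp
    simpa using this.tendsto.mono_left (nhdsWithin_le_nhds (s := Set.Iio 1))
  refine tendsto_nhds_unique hlim (hlim'.congr' ?_)
  filter_upwards [Ioo_mem_nhdsLT (show (0 : ℝ) < 1 by norm_num)] with s hs
  refine (circleAverage_log_norm_mul_circleWeight_of_lt A₀ A₁ A₂ B k hp ?_).symm
  rw [norm_mul, hw, Complex.norm_real, Real.norm_eq_abs, abs_of_pos hs.1, mul_one]
  exact hs.2

open ComplexConjugate in
lemma Real.circleAverage_eq_integral_conj {H : ℂ → ℝ} (hH : CircleIntegrable H 0 1) :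
    Real.circleAverage H 0 1 = (2 * Real.pi)⁻¹ * ∫ θ in Set.Ioo 0 Real.pi,
      (H (circleMap 0 1 θ) + H (conj (circleMap 0 1 θ))) := by
  have hint : IntervalIntegrable (fun θ ↦ H (circleMap 0 1 θ)) MeasureTheory.volume
    0 (2 * Real.pi) := hH
  have hpi := Real.pi_pos
  have h1 : IntervalIntegrable (fun θ ↦ H (circleMap 0 1 θ)) MeasureTheory.volume 0 Real.pi :=
    hint.mono_set (by
      rw [Set.uIcc_of_le hpi.le, Set.uIcc_of_le (by linarith)]
      exact Set.Icc_subset_Icc le_rfl (by linarith))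
  have h2 : IntervalIntegrable (fun θ ↦ H (circleMap 0 1 θ)) MeasureTheory.volume
      Real.pi (2 * Real.pi) :=
    hint.mono_set (by
      rw [Set.uIcc_of_le (by linarith), Set.uIcc_of_le (by linarith)]
      exact Set.Icc_subset_Icc hpi.le le_rfl)
  have hconj : ∀ θ : ℝ, conj (circleMap 0 1 θ) = circleMap 0 1 (2 * Real.pi - θ) := by
    intro θ
    apply Complex.ext <;> simp [circleMap, Complex.exp_re, Complex.exp_im]
  have h3 := h2.comp_sub_left (2 * Real.pi)
  have h4 := intervalIntegral.integral_comp_sub_left (a := 0) (b := Real.pi)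
    (fun θ ↦ H (circleMap 0 1 θ)) (2 * Real.pi)
  rw [Real.circleAverage, smul_eq_mul, ← intervalIntegral.integral_add_adjacent_intervals h1 h2,
    ← MeasureTheory.integral_Ioc_eq_integral_Ioo, ← intervalIntegral.integral_of_le hpi.le]
  simp only [hconj]
  rw [intervalIntegral.integral_add h1, h4]
  · ring_nf
  · convert h3.symm using 1 <;> ring

lemma integral_Ioo_eq_integral_cos {a b : ℝ} (hab : a < b) (g : ℝ → ℝ) :
    ∫ t in Set.Ioo a b, g t = ∫ θ in Set.Ioo 0 Real.pi,
      (b - a) / 2 * Real.sin θ * g ((a + b) / 2 + (b - a) / 2 * Real.cos θ) := by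
  have hr : 0 < (b - a) / 2 := by linarith
  have himage : (fun θ ↦ (a + b) / 2 + (b - a) / 2 * Real.cos θ) '' Set.Ioo 0 Real.pi =
      Set.Ioo a b := by
    ext t
    constructor
    · rintro ⟨θ, hθ, rfl⟩
      have hs := Real.sin_pos_of_mem_Ioo hθ
      have h := Real.sin_sq_add_cos_sq θ
      have h1 : Real.cos θ < 1 := by nlinarith
      have h2 : -1 < Real.cos θ := by nlinarith
      constructor <;> nlinarith
    · rintro ⟨h1, h2⟩
      refine ⟨Real.arccos ((t - (a + b) / 2) / ((b - a) / 2)), ⟨?_, ?_⟩, ?_⟩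
      · rw [Real.arccos_pos, div_lt_one hr]; linarith
      · refine (Real.arccos_le_pi _).lt_of_ne fun h ↦ ?_
        rw [Real.arccos_eq_pi, div_le_iff₀ hr] at h; linarith
      · dsimp only
        rw [Real.cos_arccos]
        · rw [mul_div_cancel₀ _ hr.ne']; ring
        · rw [le_div_iff₀ hr]; linarith
        · rw [div_le_one hr]; linarith
  have hd : ∀ θ ∈ Set.Ioo 0 Real.pi,
      HasDerivWithinAt (fun θ ↦ (a + b) / 2 + (b - a) / 2 * Real.cos θ)
        ((b - a) / 2 * -Real.sin θ) (Set.Ioo 0 Real.pi) θ := fun θ _ ↦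
    (((Real.hasDerivAt_cos θ).const_mul _).const_add _).hasDerivWithinAt
  have hinj : Set.InjOn (fun θ ↦ (a + b) / 2 + (b - a) / 2 * Real.cos θ) (Set.Ioo 0 Real.pi) := by
    intro θ hθ η hη h
    refine Real.injOn_cos (Set.Ioo_subset_Icc_self hθ) (Set.Ioo_subset_Icc_self hη) ?_
    exact mul_left_cancel₀ hr.ne' (add_left_cancel h)
  rw [← himage, MeasureTheory.integral_image_eq_integral_abs_deriv_smul measurableSet_Ioo hd hinj]
  refine MeasureTheory.setIntegral_congr_fun measurableSet_Ioo fun θ hθ ↦ ?_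
  have hs := Real.sin_pos_of_mem_Ioo hθ
  rw [mul_neg, abs_neg, abs_of_pos (mul_pos hr hs), smul_eq_mul]

/-- The density `densF`, transported to the unit circle. -/
noncomputable def densWeight (α p q : ℝ) (z : ℂ) : ℝ :=
  circleWeight ((q ^ 2 - p ^ 2) * (q ^ 2 - (q ^ 2 - p ^ 2) / 4) + 2 * α * (p / q))
    (-((q ^ 2 - p ^ 2) * (p ^ 2 + q ^ 2) / 2)) (-((q ^ 2 - p ^ 2) / 2) ^ 2) (-2 * α)
    (((p - q) / (p + q) : ℝ) : ℂ) z

open ComplexConjugate in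
lemma densWeight_conj (α p q : ℝ) (z : ℂ) : densWeight α p q (conj z) = densWeight α p q z := by
  have h : ‖conj z - (((p - q) / (p + q) : ℝ) : ℂ)‖ = ‖z - (((p - q) / (p + q) : ℝ) : ℂ)‖ := by
    rw [← Complex.norm_conj, map_sub, Complex.conj_conj, Complex.conj_ofReal]
  simp only [densWeight, circleWeight, poissonKernel, sub_zero, h, Complex.norm_conj,
    Complex.conj_re, ← map_pow]

lemma mul_densF_eq_densWeight (α : ℝ) {p q : ℝ} (hp : 0 < p) (hpq : p < q) {θ : ℝ}
    (hθ : θ ∈ Set.Ioo 0 Real.pi) :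
    (q ^ 2 - p ^ 2) / 2 * Real.sin θ *
      densF α (p ^ 2) (q ^ 2) ((p ^ 2 + q ^ 2) / 2 + (q ^ 2 - p ^ 2) / 2 * Real.cos θ) =
      (2 * Real.pi)⁻¹ * densWeight α p q (circleMap 0 1 θ) := by
  have hq : 0 < q := hp.trans hpq
  have hr : 0 < q ^ 2 - p ^ 2 := by nlinarith
  have hs := Real.sin_pos_of_mem_Ioo hθ
  have hsc := Real.sin_sq_add_cos_sq θ
  have hre : (circleMap 0 1 θ).re = Real.cos θ := by simp [circleMap, Complex.exp_re]
  have him : (circleMap 0 1 θ).im = Real.sin θ := by simp [circleMap, Complex.exp_im]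
  have hnorm : ‖circleMap 0 1 θ‖ = 1 := by simp
  generalize Real.cos θ = c at *
  generalize Real.sin θ = s at *
  have h1 : c < 1 := by nlinarith
  have h2 : -1 < c := by nlinarith
  have ht : 0 < (p ^ 2 + q ^ 2) / 2 + (q ^ 2 - p ^ 2) / 2 * c := by nlinarith
  have hsqrt : √((q ^ 2 - ((p ^ 2 + q ^ 2) / 2 + (q ^ 2 - p ^ 2) / 2 * c)) /
      ((p ^ 2 + q ^ 2) / 2 + (q ^ 2 - p ^ 2) / 2 * c - p ^ 2)) = (1 - c) / s := by
    rw [show (q ^ 2 - ((p ^ 2 + q ^ 2) / 2 + (q ^ 2 - p ^ 2) / 2 * c)) /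
      ((p ^ 2 + q ^ 2) / 2 + (q ^ 2 - p ^ 2) / 2 * c - p ^ 2) = ((1 - c) / s) ^ 2 from ?_]
    · exact Real.sqrt_sq (div_nonneg (by linarith) hs.le)
    · have : 0 < 1 + c := by linarith
      rw [show (q ^ 2 - ((p ^ 2 + q ^ 2) / 2 + (q ^ 2 - p ^ 2) / 2 * c)) =
        (q ^ 2 - p ^ 2) / 2 * (1 - c) by ring,
        show (p ^ 2 + q ^ 2) / 2 + (q ^ 2 - p ^ 2) / 2 * c - p ^ 2 =
          (q ^ 2 - p ^ 2) / 2 * (1 + c) by ring, div_pow,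
        show s ^ 2 = (1 - c) * (1 + c) by linarith]
      have : 0 < 1 - c := by linarith
      field_simp
  have hkernel : poissonKernel 0 (((p - q) / (p + q) : ℝ) : ℂ) (circleMap 0 1 θ) =
      p * q / ((p ^ 2 + q ^ 2) / 2 + (q ^ 2 - p ^ 2) / 2 * c) := by
    have hn : ‖circleMap 0 1 θ - (((p - q) / (p + q) : ℝ) : ℂ)‖ ^ 2 =
        4 / (p + q) ^ 2 * ((p ^ 2 + q ^ 2) / 2 + (q ^ 2 - p ^ 2) / 2 * c) := by
      rw [← Complex.normSq_eq_norm_sq, Complex.normSq_apply, Complex.sub_re, Complex.sub_im,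
        Complex.ofReal_re, Complex.ofReal_im, hre, him, sub_zero, ← sq s,
        show s ^ 2 = 1 - c ^ 2 by linarith]
      field_simp
      ring
    rw [poissonKernel, sub_zero, sub_zero, hn, hnorm, Complex.norm_real,
      Real.norm_eq_abs, sq_abs]
    field_simp
    ring
  have hre2 : (circleMap 0 1 θ ^ 2).re = 2 * c ^ 2 - 1 := by
    rw [sq, Complex.mul_re, hre, him]; linarith
  rw [densF, hsqrt, densWeight, circleWeight, hkernel, hre, hre2, ← div_pow,
    Real.sqrt_sq (by positivity)]
  set t := (p ^ 2 + q ^ 2) / 2 + (q ^ 2 - p ^ 2) / 2 * c with ht_def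
  have hc : c = (t - (p ^ 2 + q ^ 2) / 2) / ((q ^ 2 - p ^ 2) / 2) := by
    rw [ht_def]; field_simp; ring
  have hpi := Real.pi_pos
  clear_value t
  subst hc
  field_simp
  ring

lemma norm_sub_div_add_lt_one {p q : ℝ} (hp : 0 < p) (hq : 0 < q) :
    ‖(((p - q) / (p + q) : ℝ) : ℂ)‖ < 1 := by
  rw [Complex.norm_real, Real.norm_eq_abs, abs_div, abs_of_pos (add_pos hp hq),
    div_lt_one (add_pos hp hq), abs_lt]
  constructor <;> linarith

open ComplexConjugate in
lemma potU_eq_circleAverage (α : ℝ) {p q x : ℝ} (hp : 0 < p) (hpq : p < q) {w : ℂ} (hw : w ≠ 0)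
    (hx : (x : ℂ) = ((p ^ 2 + q ^ 2) / 2 : ℝ) + ((q ^ 2 - p ^ 2) / 4 : ℝ) * (w + w⁻¹)) :
    potU α (p ^ 2) (q ^ 2) x = -Real.circleAverage (fun z ↦
      ((Real.log ((q ^ 2 - p ^ 2) / 4) - Real.log ‖w‖) / 2 + Real.log ‖1 - w * z‖) *
        densWeight α p q z) 0 1 := by
  have hr : 0 < q ^ 2 - p ^ 2 := by nlinarith
  have hint : CircleIntegrable (fun z ↦
      ((Real.log ((q ^ 2 - p ^ 2) / 4) - Real.log ‖w‖) / 2 + Real.log ‖1 - w * z‖) *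
        densWeight α p q z) 0 1 := by
    have hlog : CircleIntegrable (fun z ↦ Real.log ‖1 - w * z‖) 0 1 :=
      MeromorphicOn.circleIntegrable_log_norm (f := fun z ↦ 1 - w * z) fun z _ ↦ by fun_prop
    have hcont : Continuous fun θ ↦ densWeight α p q (circleMap 0 1 θ) :=
      (continuousOn_circleWeight _ _ _ _
        (norm_sub_div_add_lt_one hp (hp.trans hpq))).comp_continuous
        (continuous_circleMap 0 1) fun θ ↦ by simp
    exact (intervalIntegrable_const.add hlog).mul_continuousOn hcont.continuousOn
  rw [Real.circleAverage_eq_integral_conj hint, potU,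
    integral_Ioo_eq_integral_cos (show p ^ 2 < q ^ 2 by linarith),
    ← MeasureTheory.integral_const_mul, ← MeasureTheory.integral_neg]
  refine MeasureTheory.setIntegral_congr_ae measurableSet_Ioo ?_
  filter_upwards [(Set.countable_singleton (Real.arccos ((x - (p ^ 2 + q ^ 2) / 2) /
    ((q ^ 2 - p ^ 2) / 2)))).ae_notMem MeasureTheory.volume] with θ hne hθ
  set t := (p ^ 2 + q ^ 2) / 2 + (q ^ 2 - p ^ 2) / 2 * Real.cos θ with ht
  have hxt : x - t ≠ 0 := by
    intro h
    apply hne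
    rw [sub_eq_zero.1 h, ht, add_sub_cancel_left, mul_div_cancel_left₀ _ (by positivity),
      Real.arccos_cos hθ.1.le hθ.2.le, Set.mem_singleton_iff]
  set z := circleMap 0 1 θ with hz
  have hzc : z * conj z = 1 := by
    rw [Complex.mul_conj, Complex.normSq_eq_norm_sq, hz]; simp
  have hre : 2 * (Real.cos θ : ℂ) = z + conj z := by
    rw [Complex.add_conj, hz]; simp [circleMap, Complex.exp_re]
  have hfac : ((x - t : ℝ) : ℂ) =
      ((q ^ 2 - p ^ 2) / 4 : ℝ) * w⁻¹ * ((1 - w * z) * (1 - w * conj z)) := by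
    have h1 : (t : ℂ) = ((p ^ 2 + q ^ 2) / 2 : ℝ) + ((q ^ 2 - p ^ 2) / 4 : ℝ) * (z + conj z) := by
      rw [← hre, ht]; push_cast; ring
    have h2 : (1 - w * z) * (1 - w * conj z) = 1 - w * (z + conj z) + w ^ 2 := by
      linear_combination w ^ 2 * hzc
    rw [Complex.ofReal_sub, hx, h1, h2]
    field_simp
    ring
  have hmul : (1 - w * z) * (1 - w * conj z) ≠ 0 := by
    intro h
    rw [h, mul_zero, Complex.ofReal_eq_zero] at hfac
    exact hxt hfac
  have hlog : Real.log |x - t| = Real.log ((q ^ 2 - p ^ 2) / 4) - Real.log ‖w‖ +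
      (Real.log ‖1 - w * z‖ + Real.log ‖1 - w * conj z‖) := by
    rw [← Real.norm_eq_abs, ← Complex.norm_real, hfac, norm_mul, norm_mul, norm_mul, norm_inv,
      Real.log_mul, Real.log_mul, Real.log_mul, Real.log_inv, Complex.norm_real,
      Real.norm_of_nonneg (by positivity)]
    · ring
    · exact norm_ne_zero_iff.2 (left_ne_zero_of_mul hmul)
    · exact norm_ne_zero_iff.2 (right_ne_zero_of_mul hmul)
    · exact norm_ne_zero_iff.2 (Complex.ofReal_ne_zero.2 (by positivity))
    · exact inv_ne_zero (norm_ne_zero_iff.2 hw)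
    · exact mul_ne_zero (norm_ne_zero_iff.2 (Complex.ofReal_ne_zero.2 (by positivity)))
        (inv_ne_zero (norm_ne_zero_iff.2 hw))
    · rw [← norm_mul]; exact norm_ne_zero_iff.2 hmul
  have hdens := mul_densF_eq_densWeight α hp hpq hθ
  rw [densWeight_conj, one_div, Real.log_inv, hlog]
  linear_combination (-(Real.log ((q ^ 2 - p ^ 2) / 4) - Real.log ‖w‖ +
      (Real.log ‖1 - w * z‖ + Real.log ‖1 - w * conj z‖))) * hdens

/-- The logarithmic potential in the Joukowsky coordinate `w` of the point `x`. -/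
lemma potU_eq (α : ℝ) {p q x : ℝ} (hp : 0 < p) (hpq : p < q) {w : ℂ} (hw : w ≠ 0)
    (hw1 : ‖w‖ ≤ 1)
    (hx : (x : ℂ) = ((p ^ 2 + q ^ 2) / 2 : ℝ) + ((q ^ 2 - p ^ 2) / 4 : ℝ) * (w + w⁻¹))
    (hψ : psiFun α (q ^ 2) (p ^ 2) = 0) :
    potU α (p ^ 2) (q ^ 2) x = Real.log ‖w‖ - Real.log ((q ^ 2 - p ^ 2) / 4)
      - (q ^ 2 - p ^ 2) * (p ^ 2 + q ^ 2) / 4 * w.re - (q ^ 2 - p ^ 2) ^ 2 / 16 * (w ^ 2).re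
      + 2 * α * Real.log ‖1 - w * ((p - q) / (p + q) : ℝ)‖ := by
  have hq : 0 < q := hp.trans hpq
  rw [psiFun, Real.sqrt_sq hp.le, Real.sqrt_sq hq.le] at hψ
  rw [potU_eq_circleAverage α hp hpq hw hx]
  simp only [densWeight]
  rw [circleAverage_log_norm_mul_circleWeight _ _ _ _ _ (norm_sub_div_add_lt_one hp hq) hw1]
  linear_combination (Real.log ‖w‖ - Real.log ((q ^ 2 - p ^ 2) / 4)) / 2 * hψ

/-- `U + Q / 2` minus its value on `[p ^ 2, q ^ 2]`, in the Joukowsky coordinate `w`. -/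
noncomputable def excess (α p q w : ℝ) : ℝ :=
  Real.log w + (q ^ 2 - p ^ 2) * (p ^ 2 + q ^ 2) / 8 * (w⁻¹ - w)
    + (q ^ 2 - p ^ 2) ^ 2 / 32 * ((w⁻¹) ^ 2 - w ^ 2)
    + α * (Real.log (1 - w * ((p - q) / (p + q))) - Real.log (1 - w⁻¹ * ((p - q) / (p + q))))

/-- The value of `U + Q / 2` on `[p ^ 2, q ^ 2]`. -/
noncomputable def equilibriumConst (α p q : ℝ) : ℝ :=
  (p ^ 2 + q ^ 2) ^ 2 / 8 + (q ^ 2 - p ^ 2) ^ 2 / 16 - Real.log ((q ^ 2 - p ^ 2) / 4)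
    - α * Real.log (((p + q) / 2) ^ 2)

lemma joukowsky_eq_mul {p q w : ℝ} (hpq : p + q ≠ 0) (hw : w ≠ 0) :
    (p ^ 2 + q ^ 2) / 2 + (q ^ 2 - p ^ 2) / 4 * (w + w⁻¹) =
      ((p + q) / 2) ^ 2 * ((1 - w * ((p - q) / (p + q))) * (1 - w⁻¹ * ((p - q) / (p + q)))) := by
  field_simp
  ring

lemma hasDerivAt_excess {α p q w : ℝ} (hp : 0 < p) (hpq : p < q) (hw : w ≠ 0)
    (h1 : 1 - w * ((p - q) / (p + q)) ≠ 0) (h2 : 1 - w⁻¹ * ((p - q) / (p + q)) ≠ 0)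
    (hψ : psiFun α (q ^ 2) (p ^ 2) = 0) {x : ℝ}
    (hx : x = (p ^ 2 + q ^ 2) / 2 + (q ^ 2 - p ^ 2) / 4 * (w + w⁻¹)) :
    HasDerivAt (excess α p q)
      (-(w⁻¹ * (1 / 2 * ((x - q ^ 2) * (2 * x + q ^ 2 - p ^ 2 - 2 * α * (p / q) / x))))) w := by
  have hq : 0 < q := hp.trans hpq
  have hs : p + q ≠ 0 := by positivity
  have hx0 : x ≠ 0 := by
    rw [hx, joukowsky_eq_mul hs hw]
    positivity
  have d0 := Real.hasDerivAt_log hw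
  have di := hasDerivAt_inv hw
  have did := hasDerivAt_id w
  have d1 := ((did.mul_const ((p - q) / (p + q))).const_sub 1).log h1
  have d2 := ((di.mul_const ((p - q) / (p + q))).const_sub 1).log h2
  have d := ((d0.add ((di.sub did).const_mul ((q ^ 2 - p ^ 2) * (p ^ 2 + q ^ 2) / 8))).add
    (((di.pow 2).sub (did.pow 2)).const_mul ((q ^ 2 - p ^ 2) ^ 2 / 32))).add
    ((d1.sub d2).const_mul α)
  refine d.congr_deriv ?_
  rw [psiFun, Real.sqrt_sq hp.le, Real.sqrt_sq hq.le] at hψ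
  have hfrac : -(1 * ((p - q) / (p + q))) / (1 - w * ((p - q) / (p + q))) -
      -(-(w ^ 2)⁻¹ * ((p - q) / (p + q))) / (1 - w⁻¹ * ((p - q) / (p + q))) =
      w⁻¹ * (1 - p * q / x) := by
    rw [hx, joukowsky_eq_mul hs hw]
    have e1 : p + q - w * (p - q) ≠ 0 := by
      intro h; apply h1; field_simp; linarith
    have e2 : w * (p + q) - (p - q) ≠ 0 := by
      intro h; apply h2; field_simp; linarith
    have f1 : 1 - w * ((p - q) / (p + q)) = (p + q - w * (p - q)) / (p + q) := by field_simp
    have f2 : 1 - w⁻¹ * ((p - q) / (p + q)) = (w * (p + q) - (p - q)) / (w * (p + q)) := by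
      field_simp
    rw [f1, f2]
    generalize hu : p + q - w * (p - q) = u at *
    generalize hv : w * (p + q) - (p - q) = v at *
    field_simp
    rw [← hu, ← hv]
    ring
  dsimp only [id]
  rw [hfrac]
  have hpx : α * (p / q) / x * (x - q ^ 2) = α * (p / q) - α * (p * q / x) := by
    field_simp
  have hone : (1 : ℝ) = 3 / 8 * (q ^ 2 - p ^ 2) ^ 2 + p ^ 2 * (q ^ 2 - p ^ 2) / 2 + α * (p / q)
      - α := by linear_combination (-1 / 2 : ℝ) * hψ
  have hexpand : -(w⁻¹ * (1 / 2 * ((x - q ^ 2) * (2 * x + q ^ 2 - p ^ 2 - 2 * α * (p / q) / x)))) =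
      -w⁻¹ * ((x - q ^ 2) * (x + (q ^ 2 - p ^ 2) / 2) - (α * (p / q) - α * (p * q / x))) := by
    rw [← hpx]; ring
  have hmain : 1 + (q ^ 2 - p ^ 2) * (p ^ 2 + q ^ 2) / 8 * (-w⁻¹ - w)
      + (q ^ 2 - p ^ 2) ^ 2 / 16 * (-(w⁻¹) ^ 2 - w ^ 2) + α =
      -((x - q ^ 2) * (x + (q ^ 2 - p ^ 2) / 2)) + α * (p / q) := by
    rw [hx]
    linear_combination hone + (q ^ 2 - p ^ 2) ^ 2 / 8 * mul_inv_cancel₀ hw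
  rw [hexpand]
  have hww := mul_inv_cancel₀ hw
  simp only [← inv_pow]
  push_cast
  linear_combination w⁻¹ * hmain +
    ((q ^ 2 - p ^ 2) * (p ^ 2 + q ^ 2) / 8 + (q ^ 2 - p ^ 2) ^ 2 / 16 * w) * hww

lemma two_le_add_inv {y : ℝ} (hy : 0 < y) : 2 ≤ y + y⁻¹ := by
  have h := mul_inv_cancel₀ hy.ne'
  have h' : 0 < y⁻¹ := inv_pos.2 hy
  nlinarith [sq_nonneg (y - y⁻¹)]

lemma excess_nonneg_of_pos {α p q w : ℝ} (hp : 0 < p) (hpq : p < q) (hw : 0 < w) (hw1 : w ≤ 1)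
    (hψ : psiFun α (q ^ 2) (p ^ 2) = 0) (hφ : 0 ≤ phiFun α (q ^ 2) (p ^ 2)) :
    0 ≤ excess α p q w := by
  have hq : 0 < q := hp.trans hpq
  have hr : 0 < q ^ 2 - p ^ 2 := by nlinarith
  have hρ : (p - q) / (p + q) < 0 := div_neg_of_neg_of_pos (by linarith) (by positivity)
  rw [phiFun, ← mul_pow, Real.sqrt_sq (by positivity), sub_nonneg, div_le_iff₀ (by positivity)]
    at hφ
  have hder : ∀ y ∈ Set.Icc w 1, ∃ d ≤ 0, HasDerivAt (excess α p q) d y := by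
    intro y hy
    have hy0 : 0 < y := hw.trans_le hy.1
    have hyinv : 0 < y⁻¹ := inv_pos.2 hy0
    refine ⟨_, ?_, hasDerivAt_excess hp hpq hy0.ne' ?_ ?_ hψ rfl⟩
    · have hx : q ^ 2 ≤ (p ^ 2 + q ^ 2) / 2 + (q ^ 2 - p ^ 2) / 4 * (y + y⁻¹) := by
        nlinarith [two_le_add_inv hy0]
      set x := (p ^ 2 + q ^ 2) / 2 + (q ^ 2 - p ^ 2) / 4 * (y + y⁻¹)
      have hx0 : 0 < x := lt_of_lt_of_le (by positivity) hx
      have hα : 2 * α * (p / q) ≤ p ^ 2 * (q ^ 2 + p ^ 2) := by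
        rw [mul_div_assoc', div_le_iff₀ hq]
        nlinarith
      have h : 2 * α * (p / q) / x ≤ 2 * x + q ^ 2 - p ^ 2 := by
        rw [div_le_iff₀ hx0]
        nlinarith [mul_nonneg (sub_nonneg.2 hx) hr.le, mul_self_le_mul_self (by positivity) hx,
          mul_pos hr hr, mul_pos hr (sq_pos_of_pos hq)]
      exact neg_nonpos.2 (mul_nonneg hyinv.le (mul_nonneg (by norm_num)
        (mul_nonneg (by linarith) (by linarith))))
    · nlinarith
    · nlinarith
  have hanti : AntitoneOn (excess α p q) (Set.Icc w 1) := by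
    refine antitoneOn_of_deriv_nonpos (convex_Icc _ _) (fun y hy ↦ ?_) (fun y hy ↦ ?_) fun y hy ↦ ?_
    · obtain ⟨d, -, hd⟩ := hder y hy
      exact hd.continuousAt.continuousWithinAt
    · obtain ⟨d, -, hd⟩ := hder y (interior_subset hy)
      exact hd.differentiableAt.differentiableWithinAt
    · obtain ⟨d, hd0, hd⟩ := hder y (interior_subset hy)
      exact hd.deriv.trans_le hd0
  have h := hanti ⟨le_rfl, hw1⟩ ⟨hw1, le_rfl⟩ hw1
  simpa [excess] using h

lemma excess_nonneg_of_neg {α p q w : ℝ} (hp : 0 < p) (hpq : p < q) (hw : -1 ≤ w)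
    (hw1 : w < (p - q) / (p + q))
    (hψ : psiFun α (q ^ 2) (p ^ 2) = 0) (hφ : phiFun α (q ^ 2) (p ^ 2) = 0) :
    0 ≤ excess α p q w := by
  have hq : 0 < q := hp.trans hpq
  have hr : 0 < q ^ 2 - p ^ 2 := by nlinarith
  have hρ : (p - q) / (p + q) < 0 := div_neg_of_neg_of_pos (by linarith) (by positivity)
  rw [phiFun, ← mul_pow, Real.sqrt_sq (by positivity), sub_eq_zero, eq_div_iff (by positivity)]
    at hφ
  have hder : ∀ y ∈ Set.Icc (-1) w, ∃ d ≥ 0, HasDerivAt (excess α p q) d y := by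
    intro y hy
    have hyρ : y < (p - q) / (p + q) := hy.2.trans_lt hw1
    have hy0 : y < 0 := hyρ.trans hρ
    have hyinv : y⁻¹ < 0 := inv_lt_zero.2 hy0
    have h1 : 0 < 1 - y * ((p - q) / (p + q)) := by nlinarith [hy.1]
    have h2 : 0 < 1 - y⁻¹ * ((p - q) / (p + q)) := by
      have := mul_inv_cancel₀ hy0.ne
      nlinarith
    refine ⟨_, ?_, hasDerivAt_excess hp hpq hy0.ne h1.ne' h2.ne' hψ rfl⟩
    have hx : (p ^ 2 + q ^ 2) / 2 + (q ^ 2 - p ^ 2) / 4 * (y + y⁻¹) ≤ p ^ 2 := by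
      have := two_le_add_inv (neg_pos.2 hy0)
      rw [inv_neg] at this
      nlinarith
    have hx0 : 0 < (p ^ 2 + q ^ 2) / 2 + (q ^ 2 - p ^ 2) / 4 * (y + y⁻¹) := by
      rw [joukowsky_eq_mul (by positivity) hy0.ne]
      positivity
    set x := (p ^ 2 + q ^ 2) / 2 + (q ^ 2 - p ^ 2) / 4 * (y + y⁻¹)
    have hα : 2 * α * (p / q) = p ^ 2 * (q ^ 2 + p ^ 2) := by
      rw [mul_div_assoc', div_eq_iff hq.ne']
      linear_combination -p * hφ
    have h : 2 * x + q ^ 2 - p ^ 2 ≤ 2 * α * (p / q) / x := by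
      rw [le_div_iff₀ hx0, hα]
      nlinarith [mul_nonneg (sub_nonneg.2 hx) (by positivity : 0 ≤ 2 * x + p ^ 2 + q ^ 2)]
    refine neg_nonneg.2 (mul_nonpos_of_nonpos_of_nonneg hyinv.le (mul_nonneg (by norm_num)
      (mul_nonneg_of_nonpos_of_nonpos (by linarith) (by linarith))))
  have hmono : MonotoneOn (excess α p q) (Set.Icc (-1) w) := by
    refine monotoneOn_of_deriv_nonneg (convex_Icc _ _) (fun y hy ↦ ?_) (fun y hy ↦ ?_) fun y hy ↦ ?_
    · obtain ⟨d, -, hd⟩ := hder y hy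
      exact hd.continuousAt.continuousWithinAt
    · obtain ⟨d, -, hd⟩ := hder y (interior_subset hy)
      exact hd.differentiableAt.differentiableWithinAt
    · obtain ⟨d, hd0, hd⟩ := hder y (interior_subset hy)
      exact hd0.trans_eq hd.deriv.symm
  have h := hmono ⟨le_rfl, hw⟩ ⟨hw, le_rfl⟩ hw
  simpa [excess] using h

lemma potU_add_extQ_eq (α : ℝ) {p q x w : ℝ} (hp : 0 < p) (hpq : p < q) (hx0 : 0 < x) (hw : w ≠ 0)
    (hw1 : |w| ≤ 1) (hx : x = (p ^ 2 + q ^ 2) / 2 + (q ^ 2 - p ^ 2) / 4 * (w + w⁻¹))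
    (hψ : psiFun α (q ^ 2) (p ^ 2) = 0) :
    potU α (p ^ 2) (q ^ 2) x + 1 / 2 * extQ α x = equilibriumConst α p q + excess α p q w := by
  have hq : 0 < q := hp.trans hpq
  have hU := potU_eq α hp hpq (x := x) (w := (w : ℂ)) (by exact_mod_cast hw)
    (by rwa [Complex.norm_real, Real.norm_eq_abs]) (by rw [hx]; push_cast; rfl) hψ
  have hmul := hx.trans (joukowsky_eq_mul (by positivity) hw)
  have hne : (1 - w * ((p - q) / (p + q))) * (1 - w⁻¹ * ((p - q) / (p + q))) ≠ 0 := by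
    intro h
    rw [h, mul_zero] at hmul
    exact hx0.ne' hmul
  have hlog : Real.log x = Real.log (((p + q) / 2) ^ 2) +
      (Real.log (1 - w * ((p - q) / (p + q))) + Real.log (1 - w⁻¹ * ((p - q) / (p + q)))) := by
    rw [hmul, Real.log_mul (by positivity) hne,
      Real.log_mul (left_ne_zero_of_mul hne) (right_ne_zero_of_mul hne)]
  have hnorm : Real.log ‖(1 : ℂ) - w * ((p - q) / (p + q) : ℝ)‖ =
      Real.log (1 - w * ((p - q) / (p + q))) := by
    rw [← Complex.ofReal_mul, ← Complex.ofReal_one, ← Complex.ofReal_sub, Complex.norm_real,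
      Real.norm_eq_abs, Real.log_abs]
  rw [hU, hnorm, extQ, hlog, hx, Complex.norm_real, Real.norm_eq_abs, Real.log_abs,
    ← Complex.ofReal_pow, Complex.ofReal_re, Complex.ofReal_re, equilibriumConst, excess]
  have hww := mul_inv_cancel₀ hw
  linear_combination (q ^ 2 - p ^ 2) ^ 2 / 16 * hww

lemma potU_add_extQ_eq_const (α : ℝ) {p q x : ℝ} (hp : 0 < p) (hpq : p < q)
    (hx : x ∈ Set.Icc (p ^ 2) (q ^ 2)) (hψ : psiFun α (q ^ 2) (p ^ 2) = 0) :
    potU α (p ^ 2) (q ^ 2) x + 1 / 2 * extQ α x = equilibriumConst α p q := by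
  have hq : 0 < q := hp.trans hpq
  have hr : 0 < q ^ 2 - p ^ 2 := by nlinarith
  have hx0 : 0 < x := lt_of_lt_of_le (by positivity) hx.1
  obtain ⟨θ, hθ⟩ : ∃ θ, Real.cos θ = (x - (p ^ 2 + q ^ 2) / 2) / ((q ^ 2 - p ^ 2) / 2) := by
    refine ⟨_, Real.cos_arccos ?_ ?_⟩
    · rw [le_div_iff₀ (by positivity)]; linarith [hx.1]
    · rw [div_le_one (by positivity)]; linarith [hx.2]
  have hxθ : x = (p ^ 2 + q ^ 2) / 2 + (q ^ 2 - p ^ 2) / 2 * Real.cos θ := by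
    rw [hθ]; field_simp; ring
  set w := circleMap 0 1 θ with hw
  have hre : w.re = Real.cos θ := by simp [hw, circleMap, Complex.exp_re]
  have him : w.im = Real.sin θ := by simp [hw, circleMap, Complex.exp_im]
  have hnorm : ‖w‖ = 1 := by simp [hw]
  have hw0 : w ≠ 0 := norm_ne_zero_iff.1 (by rw [hnorm]; exact one_ne_zero)
  have hsum : w + w⁻¹ = 2 * (Real.cos θ : ℂ) := by
    rw [Complex.inv_def, Complex.normSq_eq_norm_sq, hnorm, one_pow, inv_one, Complex.ofReal_one,
      mul_one, Complex.add_conj, hre]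
    push_cast; rfl
  have hU := potU_eq α hp hpq hw0 hnorm.le (x := x)
    (by rw [hsum, hxθ]; push_cast; ring) hψ
  have hsc := Real.sin_sq_add_cos_sq θ
  have hlog : Real.log x = Real.log (((p + q) / 2) ^ 2) +
      2 * Real.log ‖1 - w * ((p - q) / (p + q) : ℝ)‖ := by
    have h : x = ((p + q) / 2) ^ 2 * ‖1 - w * ((p - q) / (p + q) : ℝ)‖ ^ 2 := by
      rw [← Complex.normSq_eq_norm_sq, Complex.normSq_apply, Complex.sub_re, Complex.sub_im,
        Complex.re_mul_ofReal, Complex.im_mul_ofReal, hre, him, Complex.one_re, Complex.one_im, hxθ]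
      field_simp
      linear_combination (-(p - q) ^ 2) * hsc
    have hn : ‖1 - w * ((p - q) / (p + q) : ℝ)‖ ^ 2 ≠ 0 := by
      intro h'
      rw [h', mul_zero] at h
      exact hx0.ne' h
    conv_lhs => rw [h]
    rw [Real.log_mul (by positivity) hn, Real.log_pow ‖_‖ 2, Nat.cast_ofNat]
  have hre2 : (w ^ 2).re = 2 * Real.cos θ ^ 2 - 1 := by
    rw [sq, Complex.mul_re, hre, him]; linarith
  rw [hU, extQ, hlog, hnorm, Real.log_one, hre, hre2, hxθ, equilibriumConst]
  ring

lemma exists_joukowsky_eq {u v : ℝ} (hv0 : 0 ≤ v) (huv : v < u) :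
    ∃ w, 0 < w ∧ w ≤ 1 ∧ (u - v) * (w + w⁻¹) = 2 * (u + v) := by
  have hlt : √v < √u := Real.sqrt_lt_sqrt hv0 huv
  have hv := Real.sqrt_nonneg v
  have hpos : 0 < √u + √v := by linarith
  have hsub : 0 < √u - √v := by linarith
  refine ⟨(√u - √v) / (√u + √v), by positivity, ?_, ?_⟩
  · rw [div_le_one hpos]; linarith
  · have h1 := Real.sq_sqrt hv0
    have h2 := Real.sq_sqrt (hv0.trans huv.le)
    generalize √u = s at *
    generalize √v = t at *
    subst h1 h2
    field_simp
    ring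
/-- Equilibrium conditions: there is `C` with `U + Q_α/2 = C` on `[a,b]`,
`U + Q_α/2 ≥ C` on `[b, ∞)`, and (when `φ_α(b,a) = 0`) `U + Q_α/2 ≥ C` on `(0, a]`. -/
theorem equilibrium_conditions (α a b : ℝ) (hα : 0 ≤ α) (ha : 0 < a) (hab : a < b)
    (hψ : psiFun α b a = 0) (hφ : 0 ≤ phiFun α b a) :
    ∃ C : ℝ,
      (∀ x ∈ Set.Icc a b, potU α a b x + (1 / 2) * extQ α x = C) ∧
      (∀ x : ℝ, b ≤ x → C ≤ potU α a b x + (1 / 2) * extQ α x) ∧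
      (phiFun α b a = 0 →
        ∀ x ∈ Set.Ioc (0 : ℝ) a, C ≤ potU α a b x + (1 / 2) * extQ α x) := by
  obtain ⟨p, hp, rfl⟩ : ∃ p, 0 < p ∧ a = p ^ 2 :=
    ⟨√a, Real.sqrt_pos.2 ha, (Real.sq_sqrt ha.le).symm⟩
  obtain ⟨q, hq, rfl⟩ : ∃ q, 0 < q ∧ b = q ^ 2 :=
    ⟨√b, Real.sqrt_pos.2 (ha.trans hab), (Real.sq_sqrt (ha.trans hab).le).symm⟩
  have hpq : p < q := lt_of_pow_lt_pow_left₀ 2 hq.le hab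
  refine ⟨equilibriumConst α p q, fun x hx ↦ potU_add_extQ_eq_const α hp hpq hx hψ,
    fun x hx ↦ ?_, fun hφ0 x hx ↦ ?_⟩
  · obtain ⟨w, hw0, hw1, hw⟩ := exists_joukowsky_eq (u := x - p ^ 2) (v := x - q ^ 2)
      (by linarith) (by linarith)
    rw [potU_add_extQ_eq α hp hpq (by linarith) hw0.ne' (by rwa [abs_of_pos hw0])
      (by linear_combination (-1 / 4 : ℝ) * hw) hψ]
    linarith [excess_nonneg_of_pos hp hpq hw0 hw1 hψ hφ]
  · obtain ⟨w, hw0, hw1, hw⟩ := exists_joukowsky_eq (u := q ^ 2 - x) (v := p ^ 2 - x)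
      (by linarith [hx.2]) (by linarith)
    have hx' : x = (p ^ 2 + q ^ 2) / 2 + (q ^ 2 - p ^ 2) / 4 * (-w + (-w)⁻¹) := by
      rw [inv_neg]; linear_combination (1 / 4 : ℝ) * hw
    have hlt : -w < (p - q) / (p + q) := by
      have hmul := hx'.symm.trans_gt hx.1
      rw [joukowsky_eq_mul (by positivity) (neg_ne_zero.2 hw0.ne')] at hmul
      have hρ : -1 < (p - q) / (p + q) := by rw [lt_div_iff₀ (by positivity)]; linarith
      have hρ' : (p - q) / (p + q) < 0 := div_neg_of_neg_of_pos (by linarith) (by positivity)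
      have h1 : 0 < 1 - -w * ((p - q) / (p + q)) := by nlinarith
      have h2 := pos_of_mul_pos_right (pos_of_mul_pos_right hmul (by positivity)) h1.le
      have hww := mul_inv_cancel₀ hw0.ne'
      rw [inv_neg] at h2
      nlinarith [mul_pos hw0 h2]
    rw [potU_add_extQ_eq α hp hpq hx.1 (neg_ne_zero.2 hw0.ne')
      (by rwa [abs_neg, abs_of_pos hw0]) hx' hψ]
    linarith [excess_nonneg_of_neg hp hpq (neg_le_neg hw1) hlt hψ hφ0]
end
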